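/- Under the stated assumptions on the stationary memoryless source and with ε ∈ (0,1), there exist a constant C > 0 and an integer N such that for all n ≥ N, |R*_F(n, D, ε) − R_X(D) − √(V_X(D)/n) · Q⁻¹(ε)| ≤ C·(log n)/n; that is, the minimum fixed-length coding rate satisfies R*_F(n, D, ε) = R_X(D) + √(V_X(D)/n)·Q⁻¹(ε) + O((log n)/n). -/

import Mathlib

open scoped ENNReal
open MeasureTheory

noncomputable section

/-- The smooth max entropy `H^δ(P)` (base 2) of a probability distribution `P`
on a finite alphabet `𝒴`: the least `log₂ |𝒲|` over subsets `𝒲 ⊆ 𝒴` of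
probability at least `1 - δ`. -/
def smoothMaxEnt {𝒴 : Type} [Fintype 𝒴] (P : 𝒴 → ℝ≥0∞) (δ : ℝ) : ℝ :=
  sInf {r : ℝ | ∃ W : Finset 𝒴,
    ENNReal.ofReal (1 - δ) ≤ ∑ y ∈ W, P y ∧ r = Real.logb 2 (W.card)}

/-- A channel (conditional probability distribution) from `𝒳` to `𝒴`. -/
def IsChannel {𝒳 𝒴 : Type} [Fintype 𝒴] (W : 𝒳 → 𝒴 → ℝ≥0∞) : Prop :=
  ∀ x, ∑ y, W x y = 1

/-- The output marginal distribution of the channel `W` with input distribution `pX`. -/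
def marginal {𝒳 𝒴 : Type} [Fintype 𝒳] (pX : 𝒳 → ℝ≥0∞) (W : 𝒳 → 𝒴 → ℝ≥0∞) : 𝒴 → ℝ≥0∞ :=
  fun y => ∑ x, pX x * W x y

/-- `Pr{d(X,Y) > D}` for the joint law `pX · W`. -/
def chExcess {𝒳 𝒴 : Type} [Fintype 𝒳] [Fintype 𝒴] (pX : 𝒳 → ℝ≥0∞) (W : 𝒳 → 𝒴 → ℝ≥0∞)
    (d : 𝒳 → 𝒴 → ℝ) (D : ℝ) : ℝ≥0∞ :=
  ∑ x, ∑ y, if D < d x y then pX x * W x y else 0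

/-- The quantity `G^δ_{D,ε}(X)` as a value in `[0,∞]`: the infimum of the smooth max
entropy of the output marginal, over channels whose excess-distortion probability is
at most `ε`; it equals `+∞` if no such channel exists. -/
def Gq {𝒳 𝒴 : Type} [Fintype 𝒳] [Fintype 𝒴] (pX : 𝒳 → ℝ≥0∞) (d : 𝒳 → 𝒴 → ℝ)
    (D ε δ : ℝ) : ℝ≥0∞ :=
  ⨅ (W : 𝒳 → 𝒴 → ℝ≥0∞) (_ : IsChannel W) (_ : chExcess pX W d D ≤ ENNReal.ofReal ε),
    ENNReal.ofReal (smoothMaxEnt (marginal pX W) δ)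

/-- `(f, g)` is a `(D, R, ε, δ)` code: `f` is a (possibly stochastic) encoder assigning
to each source symbol a probability distribution on binary strings (`List Bool`),
`g` is a decoder, the excess distortion probability is at most `ε`, and the
overflow probability is at most `δ`. -/
def IsCode {𝒳 𝒴 : Type} [Fintype 𝒳] (pX : 𝒳 → ℝ≥0∞) (d : 𝒳 → 𝒴 → ℝ)
    (D R ε δ : ℝ) (f : 𝒳 → List Bool → ℝ≥0∞) (g : List Bool → 𝒴) : Prop :=
  (∀ x, ∑' w : List Bool, f x w = 1) ∧
  (∑ x, ∑' w : List Bool, (if D < d x (g w) then pX x * f x w else 0))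
      ≤ ENNReal.ofReal ε ∧
  (∑ x, ∑' w : List Bool, (if R < (w.length : ℝ) then pX x * f x w else 0))
      ≤ ENNReal.ofReal δ

/-- The deterministic encoder `f : 𝒳 → {0,1}*` viewed as a stochastic encoder. -/
def detEnc {𝒳 : Type} (f : 𝒳 → List Bool) : 𝒳 → List Bool → ℝ≥0∞ :=
  fun x w => if w = f x then 1 else 0

/-- The sum of the `j` largest values of `P`. -/
def topSum {𝒴 : Type} [Fintype 𝒴] (P : 𝒴 → ℝ≥0∞) (j : ℕ) : ℝ≥0∞ :=
  ⨆ (W : Finset 𝒴) (_ : W.card ≤ j), ∑ y ∈ W, P y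


/-- A channel from `𝒳` to `𝒴` given by real-valued conditional probabilities. -/
def IsRChannel {𝒳 𝒴 : Type} [Fintype 𝒴] (W : 𝒳 → 𝒴 → ℝ) : Prop :=
  (∀ x y, 0 ≤ W x y) ∧ ∀ x, ∑ y, W x y = 1

/-- `E[d(X,Y)]` for the joint law `p · W`. -/
def expDist {𝒳 𝒴 : Type} [Fintype 𝒳] [Fintype 𝒴] (p : 𝒳 → ℝ) (d : 𝒳 → 𝒴 → ℝ)
    (W : 𝒳 → 𝒴 → ℝ) : ℝ :=
  ∑ x, ∑ y, p x * W x y * d x y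

/-- Output marginal of channel `W` with input distribution `p`. -/
def outMarg {𝒳 𝒴 : Type} [Fintype 𝒳] (p : 𝒳 → ℝ) (W : 𝒳 → 𝒴 → ℝ) : 𝒴 → ℝ :=
  fun y => ∑ x, p x * W x y

/-- Mutual information `I(X;Y)` (base 2) of input `p` and channel `W`. -/
def mutualInfo {𝒳 𝒴 : Type} [Fintype 𝒳] [Fintype 𝒴] (p : 𝒳 → ℝ) (W : 𝒳 → 𝒴 → ℝ) : ℝ :=
  ∑ x, ∑ y, p x * W x y * Real.logb 2 (W x y / outMarg p W y)

/-- The rate-distortion function `D ↦ R_X(D)`. -/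
def RDfun {𝒳 𝒴 : Type} [Fintype 𝒳] [Fintype 𝒴] (p : 𝒳 → ℝ) (d : 𝒳 → 𝒴 → ℝ) : ℝ → ℝ :=
  fun D => sInf {r : ℝ | ∃ W : 𝒳 → 𝒴 → ℝ,
    IsRChannel W ∧ expDist p d W ≤ D ∧ r = mutualInfo p W}

/-- The `D`-tilted information `ȷ_X(x, D)`, with `λ* = -R_X'(D)` and
`pYstar` the optimal output marginal. -/
def DtiltedInfo {𝒳 𝒴 : Type} [Fintype 𝒳] [Fintype 𝒴] (p : 𝒳 → ℝ) (d : 𝒳 → 𝒴 → ℝ)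
    (D : ℝ) (pYstar : 𝒴 → ℝ) (x : 𝒳) : ℝ :=
  -Real.logb 2 (∑ y, pYstar y * (2 : ℝ) ^ ((-(deriv (RDfun p d) D)) * (D - d x y)))

/-- The rate-dispersion function `V_X(D) = Var[ȷ_X(X,D)]`. -/
def dispersionV {𝒳 𝒴 : Type} [Fintype 𝒳] [Fintype 𝒴] (p : 𝒳 → ℝ) (d : 𝒳 → 𝒴 → ℝ)
    (D : ℝ) (pYstar : 𝒴 → ℝ) : ℝ :=
  ∑ x, p x * (DtiltedInfo p d D pYstar x - ∑ x', p x' * DtiltedInfo p d D pYstar x') ^ 2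

/-- The Gaussian complementary cdf `Q(z) = Pr{Z > z}`, `Z` standard normal. -/
def Qfun (z : ℝ) : ℝ :=
  ∫ t in Set.Ioi z, (Real.sqrt (2 * Real.pi))⁻¹ * Real.exp (-(t ^ 2) / 2)

/-- Expectation of `G` under the product of the finite distributions `v i`. -/
def prodExp {α : Type} [Fintype α] {n : ℕ} (v : Fin n → α → ℝ) (G : (Fin n → α) → ℝ) : ℝ :=
  ∑ y, (∏ i, v i (y i)) * G y

lemma sum_update_eq {α : Type} {n : ℕ} (ξ : Fin n → α → ℝ) (y : Fin n → α) (i : Fin n) (a : α) :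
    ∑ j, ξ j (Function.update y i a j) = (∑ j, ξ j (y j)) - ξ i (y i) + ξ i a := by
  rw [← Finset.add_sum_erase _ _ (Finset.mem_univ i),
    ← Finset.add_sum_erase _ (fun j => ξ j (y j)) (Finset.mem_univ i)]
  have : ∑ j ∈ Finset.univ.erase i, ξ j (Function.update y i a j)
      = ∑ j ∈ Finset.univ.erase i, ξ j (y j) :=
    Finset.sum_congr rfl fun j hj => by
      rw [Function.update_of_ne (Finset.ne_of_mem_erase hj)]
  rw [this]
  simp only [Function.update_self]
  ring

section prodExp

variable {α : Type} [Fintype α] {n : ℕ} {v : Fin n → α → ℝ}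

lemma prodExp_prod (v g : Fin n → α → ℝ) :
    prodExp v (fun y => ∏ i, g i (y i)) = ∏ i, ∑ a, v i a * g i a := by
  classical
  rw [Finset.prod_univ_sum, Fintype.piFinset_univ]
  simp [prodExp, Finset.prod_mul_distrib]

lemma prodExp_const (hv : ∀ i, ∑ a, v i a = 1) (c : ℝ) : prodExp v (fun _ => c) = c := by
  have h := prodExp_prod v (fun _ _ => 1)
  simp only [mul_one, hv, Finset.prod_const_one] at h
  simp only [prodExp, mul_one] at h
  simp [prodExp, ← Finset.sum_mul, h]

lemma prodExp_mono (hv0 : ∀ i a, 0 ≤ v i a) {G H : (Fin n → α) → ℝ} (h : ∀ y, G y ≤ H y) :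
    prodExp v G ≤ prodExp v H :=
  Finset.sum_le_sum fun y _ =>
    mul_le_mul_of_nonneg_left (h y) (Finset.prod_nonneg fun i _ => hv0 i _)

lemma prodExp_add (G H : (Fin n → α) → ℝ) :
    prodExp v (fun y => G y + H y) = prodExp v G + prodExp v H := by
  simp [prodExp, mul_add, Finset.sum_add_distrib]

lemma prodExp_sub (G H : (Fin n → α) → ℝ) :
    prodExp v (fun y => G y - H y) = prodExp v G - prodExp v H := by
  simp [prodExp, mul_sub, Finset.sum_sub_distrib]

lemma prodExp_const_mul (c : ℝ) (G : (Fin n → α) → ℝ) :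
    prodExp v (fun y => c * G y) = c * prodExp v G := by
  simp only [prodExp, Finset.mul_sum]
  exact Finset.sum_congr rfl fun y _ => by ring

lemma prodExp_sum {κ : Type} (s : Finset κ) (G : κ → (Fin n → α) → ℝ) :
    prodExp v (fun y => ∑ k ∈ s, G k y) = ∑ k ∈ s, prodExp v (G k) := by
  simp only [prodExp, Finset.mul_sum]
  exact Finset.sum_comm

/-- Resampling one coordinate does not change a product expectation. -/
lemma prodExp_resample (hv : ∀ i, ∑ a, v i a = 1) (i : Fin n) (G : (Fin n → α) → ℝ) :
    prodExp v (fun y => ∑ a, v i a * G (Function.update y i a)) = prodExp v G := by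
  have key : ∀ (y : Fin n → α) (a : α),
      (∏ j, v j (Function.update y i a j)) * v i (y i) = (∏ j, v j (y j)) * v i a := by
    intro y a
    rw [← Finset.mul_prod_erase _ _ (Finset.mem_univ i),
      ← Finset.mul_prod_erase _ (fun j => v j (y j)) (Finset.mem_univ i)]
    have : ∏ j ∈ Finset.univ.erase i, v j (Function.update y i a j)
        = ∏ j ∈ Finset.univ.erase i, v j (y j) :=
      Finset.prod_congr rfl fun j hj => by
        rw [Function.update_of_ne (Finset.ne_of_mem_erase hj)]
    rw [this]
    simp only [Function.update_self]
    ring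
  have swap : ∑ q : (Fin n → α) × α,
        (∏ j, v j (q.1 j)) * (v i q.2 * G (Function.update q.1 i q.2))
      = ∑ q : (Fin n → α) × α, (∏ j, v j (q.1 j)) * (v i q.2 * G q.1) := by
    refine Finset.sum_bij' (fun q _ => (Function.update q.1 i q.2, q.1 i))
      (fun q _ => (Function.update q.1 i q.2, q.1 i)) (by simp) (by simp) (by simp) (by simp) ?_
    rintro ⟨y, a⟩ -
    simp only
    rw [← mul_assoc, ← mul_assoc, key]
  rw [Fintype.sum_prod_type, Fintype.sum_prod_type] at swap
  simp only [← Finset.mul_sum, ← Finset.sum_mul, hv, one_mul] at swap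
  exact swap

/-- Leave-one-out identity for a sum `S` of independent centred variables. -/
lemma prodExp_sum_mul_comp (hv : ∀ i, ∑ a, v i a = 1) {ξ : Fin n → α → ℝ}
    (hξ : ∀ i, ∑ a, v i a * ξ i a = 0) (f : ℝ → ℝ) :
    prodExp v (fun y => (∑ i, ξ i (y i)) * f (∑ i, ξ i (y i)))
      = ∑ i, prodExp v (fun y => ∑ a, v i a * (ξ i a *
          (f ((∑ j, ξ j (y j)) - ξ i (y i) + ξ i a) - f ((∑ j, ξ j (y j)) - ξ i (y i))))) := by
  simp only [Finset.sum_mul]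
  rw [prodExp_sum]
  refine Finset.sum_congr rfl fun i _ => ?_
  rw [← prodExp_resample hv i]
  congr 1
  funext y
  simp only [Function.update_self, sum_update_eq]
  have : ∑ a, v i a * (ξ i a * f ((∑ j, ξ j (y j)) - ξ i (y i))) = 0 := by
    simp only [← mul_assoc, ← Finset.sum_mul, hξ, zero_mul]
  simp only [mul_sub, Finset.sum_sub_distrib, this, sub_zero]

lemma prodExp_sum_sq (hv : ∀ i, ∑ a, v i a = 1) {ξ : Fin n → α → ℝ}
    (hξ : ∀ i, ∑ a, v i a * ξ i a = 0) :
    prodExp v (fun y => (∑ i, ξ i (y i)) ^ 2) = ∑ i, ∑ a, v i a * ξ i a ^ 2 := by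
  have h := prodExp_sum_mul_comp hv hξ id
  simp only [id, add_sub_cancel_left] at h
  simp only [pow_two]
  rw [h]
  exact Finset.sum_congr rfl fun i _ => prodExp_const hv _

/-- Hoeffding's inequality for the upper tail of a sum of independent centred variables with
values in `[-B, B]`. -/
lemma prodExp_hoeffding (hv0 : ∀ i a, 0 ≤ v i a) (hv : ∀ i, ∑ a, v i a = 1)
    {ξ : Fin n → α → ℝ} (hξ : ∀ i, ∑ a, v i a * ξ i a = 0) {B : ℝ} (hB : 0 < B)
    (hξB : ∀ i a, |ξ i a| ≤ B) (hn : 0 < n) {t : ℝ} (ht : 0 ≤ t) :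
    prodExp v (fun y => if t ≤ ∑ i, ξ i (y i) then 1 else 0)
      ≤ Real.exp (-(t ^ 2 / (2 * n * B ^ 2))) := by
  have hn' : (0 : ℝ) < n := by exact_mod_cast hn
  set s : ℝ := t / (n * B ^ 2) with hs
  have hs0 : 0 ≤ s := by positivity
  have mgf : ∀ i, ∑ a, v i a * Real.exp (s * ξ i a) ≤ Real.exp ((s * B) ^ 2 / 2) := by
    intro i
    have pt : ∀ a, Real.exp (s * ξ i a) ≤
        (B + ξ i a) / (2 * B) * Real.exp (s * B) + (B - ξ i a) / (2 * B) * Real.exp (-(s * B)) := by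
      intro a
      have h1 := abs_le.1 (hξB i a)
      have hp : 0 ≤ (B + ξ i a) / (2 * B) := div_nonneg (by linarith) (by linarith)
      have hm : 0 ≤ (B - ξ i a) / (2 * B) := div_nonneg (by linarith) (by linarith)
      have := convexOn_exp.2 (Set.mem_univ (s * B)) (Set.mem_univ (-(s * B))) hp hm
        (by field_simp; ring)
      simp only [smul_eq_mul] at this
      refine le_trans (le_of_eq ?_) this
      congr 1
      field_simp
      ring
    calc ∑ a, v i a * Real.exp (s * ξ i a)
        ≤ ∑ a, v i a * ((B + ξ i a) / (2 * B) * Real.exp (s * B)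
            + (B - ξ i a) / (2 * B) * Real.exp (-(s * B))) :=
          Finset.sum_le_sum fun a _ => mul_le_mul_of_nonneg_left (pt a) (hv0 i a)
      _ = ∑ a, (v i a * Real.cosh (s * B) + v i a * ξ i a * (Real.sinh (s * B) / B)) := by
          refine Finset.sum_congr rfl fun a _ => ?_
          rw [Real.cosh_eq, Real.sinh_eq]
          field_simp
          ring
      _ = Real.cosh (s * B) := by
          rw [Finset.sum_add_distrib, ← Finset.sum_mul, ← Finset.sum_mul, hv, hξ]
          ring
      _ ≤ _ := Real.cosh_le_exp_half_sq _
  calc prodExp v (fun y => if t ≤ ∑ i, ξ i (y i) then 1 else 0)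
      ≤ prodExp v (fun y => Real.exp (-(s * t)) * ∏ i, Real.exp (s * ξ i (y i))) := by
        refine prodExp_mono hv0 fun y => ?_
        rw [← Real.exp_sum, ← Real.exp_add, ← Finset.mul_sum]
        split_ifs with h
        · rw [Real.one_le_exp_iff]
          nlinarith
        · positivity
    _ = Real.exp (-(s * t)) * ∏ i, ∑ a, v i a * Real.exp (s * ξ i a) := by
        rw [prodExp_const_mul, prodExp_prod v (fun i a => Real.exp (s * ξ i a))]
    _ ≤ Real.exp (-(s * t)) * ∏ _i : Fin n, Real.exp ((s * B) ^ 2 / 2) := by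
        refine mul_le_mul_of_nonneg_left (Finset.prod_le_prod (fun i _ => ?_) fun i _ => mgf i)
          (Real.exp_nonneg _)
        exact Finset.sum_nonneg fun a _ => mul_nonneg (hv0 i a) (Real.exp_nonneg _)
    _ = Real.exp (-(t ^ 2 / (2 * n * B ^ 2))) := by
        rw [Finset.prod_const, Finset.card_univ, Fintype.card_fin, ← Real.exp_nat_mul,
          ← Real.exp_add]
        congr 1
        rw [hs]
        field_simp
        ring

end prodExp

/-- The standard Gaussian density. -/
def gaussDensity (t : ℝ) : ℝ := (Real.sqrt (2 * Real.pi))⁻¹ * Real.exp (-(t ^ 2) / 2)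

lemma gaussDensity_pos (t : ℝ) : 0 < gaussDensity t := by
  unfold gaussDensity
  positivity

lemma continuous_gaussDensity : Continuous gaussDensity := by
  unfold gaussDensity
  fun_prop

lemma gaussDensity_neg (t : ℝ) : gaussDensity (-t) = gaussDensity t := by
  simp [gaussDensity]

lemma integrable_gaussDensity : Integrable gaussDensity := by
  have h := (integrable_exp_neg_mul_sq (b := 1 / 2) (by norm_num)).const_mul
    (Real.sqrt (2 * Real.pi))⁻¹
  refine h.congr (Filter.Eventually.of_forall fun t => ?_)
  simp only [gaussDensity]
  congr 2
  ring

lemma integral_gaussDensity : ∫ t, gaussDensity t = 1 := by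
  have h := integral_gaussian (1 / 2)
  have e : ∀ t : ℝ, gaussDensity t
      = (Real.sqrt (2 * Real.pi))⁻¹ * Real.exp (-(1 / 2) * t ^ 2) := by
    intro t
    simp only [gaussDensity]
    congr 2
    ring
  simp only [e]
  rw [integral_const_mul, h, show Real.pi / (1 / 2) = 2 * Real.pi by ring]
  exact inv_mul_cancel₀ (by positivity)

lemma gaussDensity_le_of_abs_le {s t : ℝ} (h : |s| ≤ |t|) : gaussDensity t ≤ gaussDensity s := by
  unfold gaussDensity
  have := sq_le_sq.2 h
  gcongr

lemma gaussDensity_le_one (t : ℝ) : gaussDensity t ≤ 1 := by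
  unfold gaussDensity
  have h1 : Real.exp (-(t ^ 2) / 2) ≤ 1 := Real.exp_le_one_iff.2 (by nlinarith [sq_nonneg t])
  have h2 : (Real.sqrt (2 * Real.pi))⁻¹ ≤ 1 := by
    apply inv_le_one_of_one_le₀
    rw [Real.one_le_sqrt]
    nlinarith [Real.pi_gt_three]
  exact mul_le_one₀ h2 (Real.exp_nonneg _) h1

lemma hasDerivAt_gaussDensity (t : ℝ) : HasDerivAt gaussDensity (-t * gaussDensity t) t := by
  have h : HasDerivAt (fun t : ℝ => -(t ^ 2) / 2) (-t) t := by
    refine (((hasDerivAt_pow 2 t).neg).div_const 2).congr_deriv ?_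
    simp
    ring
  refine ((h.exp).const_mul (Real.sqrt (2 * Real.pi))⁻¹).congr_deriv ?_
  simp only [gaussDensity]
  ring

lemma Qfun_eq (z : ℝ) : Qfun z = ∫ t in Set.Ioi z, gaussDensity t := rfl

lemma integral_Iic_gaussDensity (z : ℝ) : ∫ t in Set.Iic z, gaussDensity t = Qfun (-z) := by
  have := integral_comp_neg_Iic (f := gaussDensity) z
  simp only [gaussDensity_neg] at this
  rw [this, Qfun_eq]

lemma Qfun_add_Qfun_neg (z : ℝ) : Qfun (-z) + Qfun z = 1 := by
  rw [← integral_Iic_gaussDensity, Qfun_eq,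
    intervalIntegral.integral_Iic_add_Ioi integrable_gaussDensity.integrableOn
      integrable_gaussDensity.integrableOn, integral_gaussDensity]

lemma Qfun_nonneg (z : ℝ) : 0 ≤ Qfun z :=
  setIntegral_nonneg measurableSet_Ioi fun t _ => (gaussDensity_pos t).le

lemma Qfun_le_one (z : ℝ) : Qfun z ≤ 1 := by
  linarith [Qfun_add_Qfun_neg z, Qfun_nonneg (-z)]

lemma Qfun_sub {a b : ℝ} (h : a ≤ b) : Qfun a - Qfun b = ∫ t in a..b, gaussDensity t :=
  intervalIntegral.integral_Ioi_sub_Ioi integrable_gaussDensity.integrableOn h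

lemma Qfun_sub_le {a b : ℝ} (h : a ≤ b) : Qfun a - Qfun b ≤ b - a := by
  rw [Qfun_sub h]
  have := intervalIntegral.integral_mono_on (g := fun _ => (1 : ℝ)) h
    (integrable_gaussDensity.intervalIntegrable) (by simp) fun t _ => gaussDensity_le_one t
  simpa using this

lemma le_Qfun_sub {a b m : ℝ} (h : a ≤ b) (hm : ∀ t ∈ Set.Icc a b, m ≤ gaussDensity t) :
    (b - a) * m ≤ Qfun a - Qfun b := by
  rw [Qfun_sub h]
  have := intervalIntegral.integral_mono_on (f := fun _ => m) h (by simp)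
    (integrable_gaussDensity.intervalIntegrable) hm
  simpa using this

/-- The Mills ratio bound. -/
lemma mul_Qfun_le (x : ℝ) : x * Qfun x ≤ gaussDensity x := by
  have h_integrable : Integrable fun t : ℝ => t * gaussDensity t := by
    have h := (integrable_mul_exp_neg_mul_sq (b := 1 / 2) (by norm_num)).const_mul
      (Real.sqrt (2 * Real.pi))⁻¹
    refine h.congr (Filter.Eventually.of_forall fun t => ?_)
    simp only [gaussDensity]
    rw [show -(1 / 2) * t ^ 2 = -(t ^ 2) / 2 by ring]
    ring
  have hlim : Filter.Tendsto (fun t => -gaussDensity t) Filter.atTop (nhds 0) := by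
    have h1 : Filter.Tendsto (fun t : ℝ => Real.exp (-t)) Filter.atTop (nhds 0) :=
      Real.tendsto_exp_neg_atTop_nhds_zero
    have h2 : Filter.Tendsto gaussDensity Filter.atTop (nhds 0) := by
      refine squeeze_zero' (Filter.Eventually.of_forall fun t => (gaussDensity_pos t).le) ?_ h1
      filter_upwards [Filter.eventually_ge_atTop 2] with t ht
      have h3 : Real.exp (-(t ^ 2) / 2) ≤ Real.exp (-t) := Real.exp_le_exp.2 (by nlinarith)
      have h4 : (Real.sqrt (2 * Real.pi))⁻¹ ≤ 1 := by
        apply inv_le_one_of_one_le₀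
        rw [Real.one_le_sqrt]
        nlinarith [Real.pi_gt_three]
      calc gaussDensity t ≤ 1 * Real.exp (-(t ^ 2) / 2) := by
            unfold gaussDensity
            gcongr
        _ ≤ _ := by linarith
    simpa using h2.neg
  have hval : ∫ t in Set.Ioi x, t * gaussDensity t = gaussDensity x := by
    have := integral_Ioi_of_hasDerivAt_of_tendsto' (a := x) (f := fun t => -gaussDensity t)
      (f' := fun t => t * gaussDensity t) (m := 0)
      (fun t _ => (hasDerivAt_gaussDensity t).neg.congr_deriv (by ring)) h_integrable.integrableOn hlim
    rw [this]
    ring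
  rw [Qfun_eq, ← hval, ← integral_const_mul]
  refine setIntegral_mono_on (integrable_gaussDensity.integrableOn.const_mul x)
    h_integrable.integrableOn measurableSet_Ioi fun t ht => ?_
  exact mul_le_mul_of_nonneg_right (le_of_lt ht) (gaussDensity_pos t).le

lemma Qfun_le_mul_gaussDensity {x : ℝ} (hx : 0 ≤ x) :
    Qfun x ≤ (gaussDensity 1)⁻¹ * gaussDensity x := by
  have h1 := gaussDensity_pos 1
  rw [inv_mul_eq_div, le_div_iff₀ h1]
  rcases le_total x 1 with h | h
  · calc Qfun x * gaussDensity 1 ≤ 1 * gaussDensity 1 := by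
          gcongr
          exact Qfun_le_one x
      _ ≤ gaussDensity x := by
          rw [one_mul]
          exact gaussDensity_le_of_abs_le (by rw [abs_of_nonneg hx]; simpa using h)
  · calc Qfun x * gaussDensity 1 ≤ Qfun x * 1 := by
          gcongr
          · exact Qfun_nonneg x
          · exact gaussDensity_le_one 1
      _ ≤ x * Qfun x := by nlinarith [Qfun_nonneg x]
      _ ≤ _ := mul_Qfun_le x

/-- Solution of Stein's equation for a continuous test function with values in `[0, 1]`. -/
lemma exists_stein_solution {h : ℝ → ℝ} (hc : Continuous h) (h0 : ∀ t, 0 ≤ h t)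
    (h1 : ∀ t, h t ≤ 1) :
    ∃ f : ℝ → ℝ,
      (∀ w, HasDerivAt f (w * f w + h w - ∫ t, h t * gaussDensity t) w) ∧
      (∀ w, |f w| ≤ (gaussDensity 1)⁻¹) ∧
      (∀ w, |w * f w + h w - ∫ t, h t * gaussDensity t| ≤ 2) := by
  set N := ∫ t, h t * gaussDensity t with hN
  have hφ := integrable_gaussDensity
  have hh_integrable : Integrable fun t => h t * gaussDensity t :=
    hφ.bdd_mul hc.aestronglyMeasurable (c := 1)
      (Filter.Eventually.of_forall fun t => by rw [Real.norm_eq_abs, abs_of_nonneg (h0 t)]; exact h1 t)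
  have hN0 : 0 ≤ N := integral_nonneg fun t => mul_nonneg (h0 t) (gaussDensity_pos t).le
  have hN1 : N ≤ 1 := by
    rw [← integral_gaussDensity]
    exact integral_mono hh_integrable hφ fun t =>
      (mul_le_mul_of_nonneg_right (h1 t) (gaussDensity_pos t).le).trans_eq (one_mul _)
  set g : ℝ → ℝ := fun t => (h t - N) * gaussDensity t with hg
  have hgc : Continuous g := (hc.sub continuous_const).mul continuous_gaussDensity
  have hgint : Integrable g := by
    have := hh_integrable.sub (hφ.const_mul N)
    refine this.congr (Filter.Eventually.of_forall fun t => ?_)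
    simp only [hg, Pi.sub_apply]
    ring
  have hgabs : ∀ t, |g t| ≤ gaussDensity t := by
    intro t
    rw [hg, abs_mul, abs_of_pos (gaussDensity_pos t)]
    have : |h t - N| ≤ 1 := abs_le.2 ⟨by linarith [h0 t], by linarith [h1 t]⟩
    nlinarith [gaussDensity_pos t]
  have hgtot : ∫ t, g t = 0 := by
    have : ∫ t, g t = ∫ t, (h t * gaussDensity t - N * gaussDensity t) := by
      congr 1
      funext t
      simp only [hg]
      ring
    rw [this, integral_sub hh_integrable (hφ.const_mul N), integral_const_mul, integral_gaussDensity]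
    simp [hN]
  set G : ℝ → ℝ := fun w => ∫ t in Set.Iic w, g t with hG
  have hGd : ∀ w, HasDerivAt G (g w) w := by
    intro w
    have e : G = fun u => G w + ∫ t in w..u, g t := by
      funext u
      rw [← intervalIntegral.integral_Iic_sub_Iic hgint.integrableOn hgint.integrableOn]
      ring
    rw [e]
    exact (intervalIntegral.integral_hasDerivAt_right (hgint.intervalIntegrable)
      (hgc.stronglyMeasurableAtFilter _ _) hgc.continuousAt).const_add (G w)
  have hGabs : ∀ w, |G w| ≤ Qfun |w| := by
    intro w
    rcases le_total w 0 with hw | hw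
    · rw [abs_of_nonpos hw, ← integral_Iic_gaussDensity]
      refine (abs_integral_le_integral_abs).trans ?_
      exact setIntegral_mono hgint.abs.integrableOn hφ.integrableOn hgabs
    · have : G w = -∫ t in Set.Ioi w, g t := by
        have := intervalIntegral.integral_Iic_add_Ioi (b := w) hgint.integrableOn
          hgint.integrableOn
        rw [hgtot] at this
        simp only [hG]
        linarith
      rw [abs_of_nonneg hw, this, abs_neg, Qfun_eq]
      refine (abs_integral_le_integral_abs).trans ?_
      exact setIntegral_mono hgint.abs.integrableOn hφ.integrableOn hgabs
  have habs : ∀ w, gaussDensity |w| = gaussDensity w := fun w => by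
    rcases abs_choice w with h | h <;> rw [h]
    exact gaussDensity_neg w
  refine ⟨fun w => G w / gaussDensity w, fun w => ?_, fun w => ?_, fun w => ?_⟩
  · refine ((hGd w).div (hasDerivAt_gaussDensity w) (gaussDensity_pos w).ne').congr_deriv ?_
    have := (gaussDensity_pos w).ne'
    simp only [hg]
    field_simp
    ring
  · rw [abs_div, abs_of_pos (gaussDensity_pos w), div_le_iff₀ (gaussDensity_pos w)]
    refine (hGabs w).trans ?_
    rw [← habs w]
    exact Qfun_le_mul_gaussDensity (abs_nonneg w)
  · have b1 : |w * (G w / gaussDensity w)| ≤ 1 := by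
      rw [← mul_div_assoc, abs_div, abs_of_pos (gaussDensity_pos w),
        div_le_one (gaussDensity_pos w), abs_mul, ← habs w]
      exact (mul_le_mul_of_nonneg_left (hGabs w) (abs_nonneg w)).trans (mul_Qfun_le _)
    have b2 : |h w - N| ≤ 1 := abs_le.2 ⟨by linarith [h0 w], by linarith [h1 w]⟩
    rw [add_sub_assoc]
    exact (abs_add_le _ _).trans (by linarith)

/-- The constant in the Berry–Esseen bound for bounded summands. -/
def berryEsseenConst : ℝ := 2 * (2 + (gaussDensity 1)⁻¹) + 3

lemma berryEsseenConst_pos : 0 < berryEsseenConst := by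
  have := inv_pos.2 (gaussDensity_pos 1)
  unfold berryEsseenConst
  linarith

section BerryEsseen

variable {α : Type} [Fintype α] {n : ℕ} {v ξ : Fin n → α → ℝ}

lemma berryEsseen_normalized (hv0 : ∀ i a, 0 ≤ v i a) (hv : ∀ i, ∑ a, v i a = 1)
    (hξ : ∀ i, ∑ a, v i a * ξ i a = 0) (hvar : ∑ i, ∑ a, v i a * ξ i a ^ 2 = 1)
    {β : ℝ} (hβ : 0 < β) (hξβ : ∀ i a, |ξ i a| ≤ β) (z : ℝ) :
    prodExp v (fun y => if z ≤ ∑ i, ξ i (y i) then 1 else 0)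
      ≤ Qfun z + berryEsseenConst * β := by
  set c := (gaussDensity 1)⁻¹ with hc
  set h : ℝ → ℝ := fun t => max 0 (min 1 ((t - (z - 3 * β)) / β)) with hh
  have h0 : ∀ t, 0 ≤ h t := fun t => le_max_left _ _
  have h1 : ∀ t, h t ≤ 1 := fun t => max_le zero_le_one (min_le_left _ _)
  have hcont : Continuous h := by
    simp only [hh]
    fun_prop
  have hmono : Monotone h := by
    intro s t hst
    simp only [hh]
    gcongr
  have hone : ∀ t, z - 2 * β ≤ t → h t = 1 := by
    intro t ht
    have : 1 ≤ (t - (z - 3 * β)) / β := by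
      rw [le_div_iff₀ hβ]
      linarith
    simp [hh, min_eq_left this]
  have hzero : ∀ t, t ≤ z - 3 * β → h t = 0 := by
    intro t ht
    have : (t - (z - 3 * β)) / β ≤ 0 := div_nonpos_of_nonpos_of_nonneg (by linarith) hβ.le
    simp only [hh]
    exact max_eq_left ((min_le_right _ _).trans this)
  obtain ⟨f, hfd, hfb, hfb'⟩ := exists_stein_solution hcont h0 h1
  set N := ∫ t, h t * gaussDensity t with hN
  have hNle : N ≤ Qfun z + 3 * β := by
    have : N ≤ Qfun (z - 3 * β) := by
      rw [Qfun_eq, ← integral_indicator measurableSet_Ioi]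
      refine integral_mono_of_nonneg
        (Filter.Eventually.of_forall fun t => mul_nonneg (h0 t) (gaussDensity_pos t).le)
        (integrable_gaussDensity.indicator measurableSet_Ioi)
        (Filter.Eventually.of_forall fun t => ?_)
      by_cases ht : t ∈ Set.Ioi (z - 3 * β)
      · simp only [Set.indicator_of_mem ht]
        nlinarith [h1 t, gaussDensity_pos t]
      · simp only [Set.indicator_of_notMem ht, hzero t (not_lt.1 ht), zero_mul, le_refl]
    linarith [Qfun_sub_le (a := z - 3 * β) (b := z) (by linarith)]
  have hlip : ∀ a b, |f a - f b| ≤ 2 * |a - b| := by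
    intro a b
    have := Convex.norm_image_sub_le_of_norm_hasDerivWithin_le (s := Set.univ) (C := 2)
      (f := f) (fun x _ => (hfd x).hasDerivWithinAt) (fun x _ => hfb' x) convex_univ
      (Set.mem_univ b) (Set.mem_univ a)
    simpa [Real.norm_eq_abs] using this
  have pointwise : ∀ S s x : ℝ, |s| ≤ β → |x| ≤ β →
      x ^ 2 * (S * f S + h (S - 2 * β) - N - 2 * β * (2 * |S| + c))
        ≤ x * (f (S - s + x) - f (S - s)) := by
    intro S s x hs hx
    obtain ⟨u, hu, hslope⟩ := exists_hasDerivAt_eq_slope (fun u : ℝ => f (S - s + u * x))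
      (fun u => ((S - s + u * x) * f (S - s + u * x) + h (S - s + u * x) - N) * x)
      (zero_lt_one)
      (by
        have hfc : Continuous f := continuous_iff_continuousAt.2 fun w => (hfd w).continuousAt
        fun_prop)
      (fun u _ => by
        have hin : HasDerivAt (fun u : ℝ => S - s + u * x) x u := by
          simpa using ((hasDerivAt_id u).mul_const x).const_add (S - s)
        exact (hfd _).comp u hin)
    set η := S - s + u * x with hη
    simp only [one_mul, zero_mul, add_zero, sub_zero, div_one] at hslope
    rw [← hslope]
    have hux : |u * x| ≤ β := by
      rw [abs_mul, abs_of_pos hu.1]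
      nlinarith [hu.2, hu.1, abs_nonneg x]
    have hηS : |η - S| ≤ 2 * β := by
      rw [hη, show S - s + u * x - S = u * x - s by ring]
      exact (abs_sub _ _).trans (by linarith)
    have hstep : S * f S - 2 * β * (2 * |S| + c) ≤ η * f η := by
      have e : S * f S - η * f η = S * (f S - f η) + (S - η) * f η := by ring
      have b1 : S * (f S - f η) ≤ |S| * (2 * (2 * β)) := by
        refine (le_abs_self _).trans ?_
        rw [abs_mul]
        refine mul_le_mul_of_nonneg_left ((hlip S η).trans ?_) (abs_nonneg S)
        rw [abs_sub_comm]
        linarith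
      have b2 : (S - η) * f η ≤ 2 * β * c := by
        refine (le_abs_self _).trans ?_
        rw [abs_mul, abs_sub_comm]
        exact mul_le_mul hηS (hfb η) (abs_nonneg _) (by linarith)
      linarith
    have hh' : h (S - 2 * β) ≤ h η := hmono (by linarith [(abs_le.1 hηS).1])
    nlinarith [sq_nonneg x]
  set S : (Fin n → α) → ℝ := fun y => ∑ i, ξ i (y i) with hS
  set K : (Fin n → α) → ℝ := fun y =>
    S y * f (S y) + h (S y - 2 * β) - N - 2 * β * (2 * |S y| + c) with hK
  have hlower : prodExp v K ≤ prodExp v (fun y => S y * f (S y)) := by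
    rw [prodExp_sum_mul_comp hv hξ f]
    have e : prodExp v K = ∑ i, prodExp v (fun y => ∑ a, v i a * (ξ i a ^ 2 * K y)) := by
      rw [← prodExp_sum]
      congr 1
      funext y
      simp only [← mul_assoc, ← Finset.sum_mul]
      rw [hvar, one_mul]
    rw [e]
    refine Finset.sum_le_sum fun i _ => prodExp_mono hv0 fun y => Finset.sum_le_sum fun a _ => ?_
    exact mul_le_mul_of_nonneg_left (pointwise _ _ _ (hξβ i _) (hξβ i a)) (hv0 i a)
  have habs : prodExp v (fun y => |S y|) ≤ 1 := by
    have h2 : prodExp v (fun y => |S y|) ≤ prodExp v (fun y => 1 / 2 + 1 / 2 * S y ^ 2) := by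
      refine prodExp_mono hv0 fun y => ?_
      nlinarith [sq_nonneg (|S y| - 1), sq_abs (S y)]
    rw [prodExp_add, prodExp_const hv, prodExp_const_mul, prodExp_sum_sq hv hξ, hvar] at h2
    linarith
  have hKe : prodExp v K = prodExp v (fun y => S y * f (S y))
      + prodExp v (fun y => h (S y - 2 * β)) - N
      - (4 * β * prodExp v (fun y => |S y|) + 2 * β * c) := by
    rw [hK, prodExp_sub, prodExp_sub, prodExp_add, prodExp_const hv]
    congr 1
    rw [← prodExp_const_mul, ← prodExp_const hv (2 * β * c), ← prodExp_add]
    congr 1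
    funext y
    ring
  have hind : prodExp v (fun y => if z ≤ S y then 1 else 0)
      ≤ prodExp v (fun y => h (S y - 2 * β)) := by
    refine prodExp_mono hv0 fun y => ?_
    split_ifs with hy
    · rw [hone _ (by linarith)]
    · exact h0 _
  have : berryEsseenConst * β = 4 * β * 1 + 2 * β * c + 3 * β := by
    rw [berryEsseenConst, hc]
    ring
  have h4 : 4 * β * prodExp v (fun y => |S y|) ≤ 4 * β * 1 :=
    mul_le_mul_of_nonneg_left habs (by linarith)
  linarith

/-- Berry–Esseen bound for the upper tail of a sum of independent bounded centred variables with
total variance `s ^ 2`. -/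
lemma berryEsseen_upper (hv0 : ∀ i a, 0 ≤ v i a) (hv : ∀ i, ∑ a, v i a = 1)
    (hξ : ∀ i, ∑ a, v i a * ξ i a = 0) {s : ℝ} (hs : 0 < s)
    (hvar : ∑ i, ∑ a, v i a * ξ i a ^ 2 = s ^ 2)
    {B : ℝ} (hB : 0 < B) (hξB : ∀ i a, |ξ i a| ≤ B) (z : ℝ) :
    prodExp v (fun y => if s * z ≤ ∑ i, ξ i (y i) then 1 else 0)
      ≤ Qfun z + berryEsseenConst * (B / s) := by
  have h := berryEsseen_normalized (ξ := fun i a => ξ i a / s) hv0 hv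
    (fun i => by simp only [← mul_div_assoc, ← Finset.sum_div, hξ, zero_div])
    (by simp only [div_pow, ← mul_div_assoc, ← Finset.sum_div, hvar]
        exact div_self (by positivity))
    (div_pos hB hs)
    (fun i a => by
      rw [abs_div, abs_of_pos hs]
      gcongr
      exact hξB i a) z
  simp only [← Finset.sum_div, le_div_iff₀' hs] at h
  exact h

lemma berryEsseen_lower (hv0 : ∀ i a, 0 ≤ v i a) (hv : ∀ i, ∑ a, v i a = 1)
    (hξ : ∀ i, ∑ a, v i a * ξ i a = 0) {s : ℝ} (hs : 0 < s)
    (hvar : ∑ i, ∑ a, v i a * ξ i a ^ 2 = s ^ 2)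
    {B : ℝ} (hB : 0 < B) (hξB : ∀ i a, |ξ i a| ≤ B) (z : ℝ) :
    prodExp v (fun y => if ∑ i, ξ i (y i) ≤ -(s * z) then 1 else 0)
      ≤ Qfun z + berryEsseenConst * (B / s) := by
  have h := berryEsseen_upper (ξ := fun i a => -ξ i a) hv0 hv (by simp [hξ]) hs (by simpa using hvar)
    hB (by simpa using hξB) z
  simpa only [Finset.sum_neg_distrib, le_neg] using h

/-- A sum of independent bounded centred variables with large variance falls into a short window
below its mean with probability at least a constant over its standard deviation. -/
lemma prodExp_window (hv0 : ∀ i a, 0 ≤ v i a) (hv : ∀ i, ∑ a, v i a = 1)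
    (hξ : ∀ i, ∑ a, v i a * ξ i a = 0) {s : ℝ} (hs : 0 < s)
    (hvar : ∑ i, ∑ a, v i a * ξ i a ^ 2 = s ^ 2)
    {B : ℝ} (hB : 0 < B) (hξB : ∀ i a, |ξ i a| ≤ B) {A : ℝ} (hA : 0 ≤ A) (hAs : A ≤ s) :
    (A * gaussDensity 1 - 2 * berryEsseenConst * B) / s
      ≤ prodExp v (fun y => if -A ≤ ∑ i, ξ i (y i) ∧ ∑ i, ξ i (y i) ≤ 0 then 1 else 0) := by
  have hu := berryEsseen_upper hv0 hv hξ hs hvar hB hξB 0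
  have hl := berryEsseen_lower hv0 hv hξ hs hvar hB hξB (A / s)
  rw [mul_div_cancel₀ _ hs.ne'] at hl
  rw [mul_zero] at hu
  have hsum : 1 ≤ prodExp v (fun y => if -A ≤ ∑ i, ξ i (y i) ∧ ∑ i, ξ i (y i) ≤ 0 then 1 else 0)
      + prodExp v (fun y => if 0 ≤ ∑ i, ξ i (y i) then 1 else 0)
      + prodExp v (fun y => if ∑ i, ξ i (y i) ≤ -A then 1 else 0) := by
    rw [← prodExp_add, ← prodExp_add, ← prodExp_const hv 1]
    refine prodExp_mono hv0 fun y => ?_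
    rw [prodExp_const hv]
    rcases le_total (-A) (∑ i, ξ i (y i)) with h1 | h1
    · rcases le_total (∑ i, ξ i (y i)) 0 with h2 | h2
      · rw [if_pos ⟨h1, h2⟩]
        split_ifs <;> norm_num
      · rw [if_pos h2]
        split_ifs <;> norm_num
    · rw [if_pos h1]
      split_ifs <;> norm_num
  have hQ0 : Qfun 0 + Qfun 0 = 1 := by simpa using Qfun_add_Qfun_neg 0
  have hQA := le_Qfun_sub (a := 0) (b := A / s) (m := gaussDensity 1) (by positivity) fun t ht => by
    apply gaussDensity_le_of_abs_le
    rw [abs_of_nonneg ht.1, abs_one]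
    exact ht.2.trans ((div_le_one hs).2 hAs)
  have e : (A * gaussDensity 1 - 2 * berryEsseenConst * B) / s
      = (A / s - 0) * gaussDensity 1 - 2 * (berryEsseenConst * (B / s)) := by
    field_simp
    ring
  rw [e]
  linarith

end BerryEsseen

lemma exists_forall_ge_log (K : ℝ) :
    ∃ N : ℕ, ∀ n : ℕ, N ≤ n → K * Real.log n ≤ n ∧ K ≤ n ∧ K ≤ Real.log n ∧ 3 ≤ n := by
  have hlog : Filter.Tendsto (fun n : ℕ => Real.log n) Filter.atTop Filter.atTop :=
    Real.tendsto_log_atTop.comp tendsto_natCast_atTop_atTop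
  have hsmall : ∀ᶠ n : ℕ in Filter.atTop, K * Real.log n ≤ n := by
    have h := (Real.isLittleO_log_id_atTop.bound (c := 1 / (|K| + 1)) (by positivity))
    filter_upwards [tendsto_natCast_atTop_atTop.eventually h, Filter.eventually_ge_atTop 1]
      with n hn hn1
    have hl : 0 ≤ Real.log n := Real.log_natCast_nonneg n
    simp only [id, Real.norm_eq_abs, abs_of_nonneg hl, Nat.abs_cast] at hn
    rw [div_mul_eq_mul_div, one_mul, le_div_iff₀ (by positivity)] at hn
    nlinarith [le_abs_self K]
  have := (hsmall.and ((tendsto_natCast_atTop_atTop.eventually_ge_atTop K).and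
    ((hlog.eventually_ge_atTop K).and (Filter.eventually_ge_atTop 3))))
  exact Filter.eventually_atTop.1 this

/-- Partition function of the exponential tilting of `w` by `τ * g`. -/
def tiltZ {β : Type} [Fintype β] (w g : β → ℝ) (τ : ℝ) : ℝ := ∑ b, w b * Real.exp (τ * g b)

/-- Exponential tilting of `w` by `τ * g`. -/
def tilt {β : Type} [Fintype β] (w g : β → ℝ) (τ : ℝ) (b : β) : ℝ :=
  w b * Real.exp (τ * g b) / tiltZ w g τ

/-- Mean of `g` under the tilted distribution. -/
def tiltMean {β : Type} [Fintype β] (w g : β → ℝ) (τ : ℝ) : ℝ := ∑ b, tilt w g τ b * g b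

/-- Variance of `g` under the tilted distribution. -/
def tiltVar {β : Type} [Fintype β] (w g : β → ℝ) (τ : ℝ) : ℝ :=
  ∑ b, tilt w g τ b * (g b - tiltMean w g τ) ^ 2

section tilt

variable {β : Type} [Fintype β] {w : β → ℝ} (g : β → ℝ)

lemma exp_le_tiltZ (hw0 : ∀ b, 0 ≤ w b) (hw : ∑ b, w b = 1) (τ : ℝ) :
    Real.exp (τ * ∑ b, w b * g b) ≤ tiltZ w g τ := by
  set μ := ∑ b, w b * g b with hμ
  have h : ∀ b, w b * (Real.exp (τ * μ) * (1 + τ * (g b - μ))) ≤ w b * Real.exp (τ * g b) := by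
    intro b
    refine mul_le_mul_of_nonneg_left ?_ (hw0 b)
    rw [show τ * g b = τ * μ + τ * (g b - μ) by ring, Real.exp_add]
    refine mul_le_mul_of_nonneg_left ?_ (Real.exp_nonneg _)
    linarith [Real.add_one_le_exp (τ * (g b - μ))]
  refine le_trans (le_of_eq ?_) (Finset.sum_le_sum fun b _ => h b)
  have : ∀ b, w b * (Real.exp (τ * μ) * (1 + τ * (g b - μ)))
      = Real.exp (τ * μ) * ((1 - τ * μ) * w b + τ * (w b * g b)) := fun b => by ring
  simp only [this, ← Finset.mul_sum, Finset.sum_add_distrib, hw, ← hμ]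
  ring

lemma tiltZ_pos (hw0 : ∀ b, 0 ≤ w b) (hw : ∑ b, w b = 1) (τ : ℝ) : 0 < tiltZ w g τ :=
  (Real.exp_pos _).trans_le (exp_le_tiltZ g hw0 hw τ)

lemma tilt_nonneg (hw0 : ∀ b, 0 ≤ w b) (hw : ∑ b, w b = 1) (τ : ℝ) (b : β) :
    0 ≤ tilt w g τ b :=
  div_nonneg (mul_nonneg (hw0 b) (Real.exp_nonneg _)) (tiltZ_pos g hw0 hw τ).le

lemma sum_tilt (hw0 : ∀ b, 0 ≤ w b) (hw : ∑ b, w b = 1) (τ : ℝ) : ∑ b, tilt w g τ b = 1 := by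
  simp only [tilt, ← Finset.sum_div]
  exact div_self (tiltZ_pos g hw0 hw τ).ne'

lemma tiltMean_zero (hw : ∑ b, w b = 1) : tiltMean w g 0 = ∑ b, w b * g b := by
  simp [tiltMean, tilt, tiltZ, hw]

lemma sum_tilt_centred (hw0 : ∀ b, 0 ≤ w b) (hw : ∑ b, w b = 1) (τ : ℝ) :
    ∑ b, tilt w g τ b * (g b - tiltMean w g τ) = 0 := by
  simp only [mul_sub, Finset.sum_sub_distrib, ← Finset.sum_mul, sum_tilt g hw0 hw]
  simp [tiltMean]

lemma tiltVar_nonneg (hw0 : ∀ b, 0 ≤ w b) (hw : ∑ b, w b = 1) (τ : ℝ) : 0 ≤ tiltVar w g τ :=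
  Finset.sum_nonneg fun b _ => mul_nonneg (tilt_nonneg g hw0 hw τ b) (sq_nonneg _)

lemma tiltVar_pos (hw0 : ∀ b, 0 ≤ w b) (hw : ∑ b, w b = 1) {b₁ b₂ : β} (h₁ : 0 < w b₁)
    (h₂ : 0 < w b₂) (hne : g b₁ ≠ g b₂) (τ : ℝ) : 0 < tiltVar w g τ := by
  have hpos : ∀ b, 0 < w b → 0 < tilt w g τ b := fun b hb =>
    div_pos (mul_pos hb (Real.exp_pos _)) (tiltZ_pos g hw0 hw τ)
  refine lt_of_le_of_ne (tiltVar_nonneg g hw0 hw τ) fun h0 => hne ?_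
  have hz := (Finset.sum_eq_zero_iff_of_nonneg
    (fun b _ => mul_nonneg (tilt_nonneg g hw0 hw τ b) (sq_nonneg (g b - tiltMean w g τ)))).1 h0.symm
  have e : ∀ b, 0 < w b → g b = tiltMean w g τ := by
    intro b hb
    have := (mul_eq_zero.1 (hz b (Finset.mem_univ b))).resolve_left (hpos b hb).ne'
    exact sub_eq_zero.1 (pow_eq_zero_iff two_ne_zero |>.1 this)
  rw [e b₁ h₁, e b₂ h₂]

lemma hasDerivAt_tiltMean (hw0 : ∀ b, 0 ≤ w b) (hw : ∑ b, w b = 1) (τ : ℝ) :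
    HasDerivAt (tiltMean w g) (tiltVar w g τ) τ := by
  have hexp : ∀ b, HasDerivAt (fun τ : ℝ => Real.exp (τ * g b)) (Real.exp (τ * g b) * g b) τ :=
    fun b => by simpa using ((hasDerivAt_id τ).mul_const (g b)).exp
  have hZ : HasDerivAt (tiltZ w g) (∑ b, w b * (Real.exp (τ * g b) * g b)) τ :=
    HasDerivAt.fun_sum fun b _ => (hexp b).const_mul (w b)
  have hN : HasDerivAt (fun τ => ∑ b, w b * Real.exp (τ * g b) * g b)
      (∑ b, w b * (Real.exp (τ * g b) * g b) * g b) τ :=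
    HasDerivAt.fun_sum fun b _ => ((hexp b).const_mul (w b)).mul_const (g b)
  have hZ0 := (tiltZ_pos g hw0 hw τ).ne'
  have hmean : tiltMean w g = fun τ => (∑ b, w b * Real.exp (τ * g b) * g b) / tiltZ w g τ := by
    funext τ
    simp only [tiltMean, tilt, Finset.sum_div]
    exact Finset.sum_congr rfl fun b _ => by ring
  have hvar : tiltVar w g τ = ∑ b, tilt w g τ b * g b ^ 2 - tiltMean w g τ ^ 2 := by
    have : ∀ b, tilt w g τ b * (g b - tiltMean w g τ) ^ 2
        = tilt w g τ b * g b ^ 2 - 2 * tiltMean w g τ * (tilt w g τ b * g b)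
          + tiltMean w g τ ^ 2 * tilt w g τ b := fun b => by ring
    simp only [tiltVar, this, Finset.sum_add_distrib, Finset.sum_sub_distrib, ← Finset.mul_sum,
      sum_tilt g hw0 hw]
    rw [show ∑ b, tilt w g τ b * g b = tiltMean w g τ from rfl]
    ring
  have hsq : ∑ b, tilt w g τ b * g b ^ 2
      = (∑ b, w b * (Real.exp (τ * g b) * g b) * g b) / tiltZ w g τ := by
    rw [Finset.sum_div]
    exact Finset.sum_congr rfl fun b _ => by simp only [tilt]; ring
  rw [hvar, hsq, hmean]
  refine (hN.div hZ hZ0).congr_deriv ?_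
  have : ∑ b, w b * (Real.exp (τ * g b) * g b) = ∑ b, w b * Real.exp (τ * g b) * g b :=
    Finset.sum_congr rfl fun b _ => by ring
  rw [this]
  field_simp

lemma continuous_tiltVar (hw0 : ∀ b, 0 ≤ w b) (hw : ∑ b, w b = 1) :
    Continuous (tiltVar w g) := by
  have hm : Continuous (tiltMean w g) :=
    continuous_iff_continuousAt.2 fun τ => (hasDerivAt_tiltMean g hw0 hw τ).continuousAt
  have hZ : Continuous (tiltZ w g) := by
    unfold tiltZ
    fun_prop
  unfold tiltVar
  refine continuous_finsetSum _ fun b _ => ?_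
  refine Continuous.mul ?_ ((continuous_const.sub hm).pow 2)
  unfold tilt
  exact Continuous.div (by fun_prop) hZ fun τ => (tiltZ_pos g hw0 hw τ).ne'

lemma abs_sub_tiltMean_le (hw0 : ∀ b, 0 ≤ w b) (hw : ∑ b, w b = 1) {B : ℝ}
    (hg0 : ∀ b, 0 ≤ g b) (hgB : ∀ b, g b ≤ B) (τ : ℝ) (b : β) :
    |g b - tiltMean w g τ| ≤ B := by
  have h0 : 0 ≤ tiltMean w g τ :=
    Finset.sum_nonneg fun b _ => mul_nonneg (tilt_nonneg g hw0 hw τ b) (hg0 b)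
  have h1 : tiltMean w g τ ≤ B := by
    have : tiltMean w g τ ≤ ∑ b, tilt w g τ b * B :=
      Finset.sum_le_sum fun b _ => mul_le_mul_of_nonneg_left (hgB b) (tilt_nonneg g hw0 hw τ b)
    rwa [← Finset.sum_mul, sum_tilt g hw0 hw, one_mul] at this
  exact abs_le.2 ⟨by linarith [hg0 b], by linarith [hgB b]⟩

lemma tiltVar_le (hw0 : ∀ b, 0 ≤ w b) (hw : ∑ b, w b = 1) {B : ℝ}
    (hg0 : ∀ b, 0 ≤ g b) (hgB : ∀ b, g b ≤ B) (τ : ℝ) : tiltVar w g τ ≤ B ^ 2 := by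
  have : tiltVar w g τ ≤ ∑ b, tilt w g τ b * B ^ 2 := by
    refine Finset.sum_le_sum fun b _ => mul_le_mul_of_nonneg_left ?_ (tilt_nonneg g hw0 hw τ b)
    have h := abs_sub_tiltMean_le g hw0 hw hg0 hgB τ b
    rw [← sq_abs]
    exact pow_le_pow_left₀ (abs_nonneg _) h 2
  rwa [← Finset.sum_mul, sum_tilt g hw0 hw, one_mul] at this

end tilt

/-- Local lower bound at moderate deviations: independent letters `Y i` distributed as `w (xs i)`
have total distortion in a bounded window below `m` with at least polynomially small probability,
as soon as `m` is within `O(√(n log n))` of the mean and a letter `x₀` whose distortion is random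
occurs a positive fraction of the time. -/
lemma exists_moderate_window {𝒳 𝒴 : Type} [Fintype 𝒴] [DecidableEq 𝒳] {w d : 𝒳 → 𝒴 → ℝ}
    (hw0 : ∀ x y, 0 ≤ w x y) (hw : ∀ x, ∑ y, w x y = 1) {B : ℝ} (hB : 0 < B)
    (hd0 : ∀ x y, 0 ≤ d x y) (hdB : ∀ x y, d x y ≤ B) {x₀ : 𝒳} {y₁ y₂ : 𝒴}
    (h₁ : 0 < w x₀ y₁) (h₂ : 0 < w x₀ y₂) (hne : d x₀ y₁ ≠ d x₀ y₂)
    {ρ : ℝ} (hρ : 0 < ρ) {K : ℝ} (hK : 0 < K) :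
    ∃ A C : ℝ, 0 ≤ A ∧ 0 ≤ C ∧ ∃ N : ℕ, ∀ n : ℕ, N ≤ n → ∀ (xs : Fin n → 𝒳) (m : ℝ),
      |∑ i, ∑ y, w (xs i) y * d (xs i) y - m| ≤ K * Real.sqrt (n * Real.log n) →
      ρ * n ≤ ∑ i, (if xs i = x₀ then 1 else 0 : ℝ) →
      Real.exp (-(C * Real.log n)) ≤ prodExp (fun i => w (xs i))
        (fun y => if m - A ≤ ∑ i, d (xs i) (y i) ∧ ∑ i, d (xs i) (y i) ≤ m then 1 else 0) := by
  obtain ⟨τ₀, -, hτ₀⟩ := isCompact_Icc.exists_isMinOn (Set.nonempty_Icc.2 (by norm_num : (-1:ℝ) ≤ 1))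
    (continuous_tiltVar (d x₀) (hw0 x₀) (hw x₀)).continuousOn
  set c := tiltVar (w x₀) (d x₀) τ₀ with hc
  have hc0 : 0 < c := tiltVar_pos (d x₀) (hw0 x₀) (hw x₀) h₁ h₂ hne τ₀
  have hcmin : ∀ τ ∈ Set.Icc (-1 : ℝ) 1, c ≤ tiltVar (w x₀) (d x₀) τ := fun τ hτ => hτ₀ hτ
  set κ := K / (ρ * c) with hκ
  have hκ0 : 0 < κ := by positivity
  set A := (2 * berryEsseenConst * B + 1) / gaussDensity 1 with hA
  have hA0 : 0 ≤ A := by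
    have := berryEsseenConst_pos
    have := gaussDensity_pos 1
    positivity
  obtain ⟨N, hN⟩ := exists_forall_ge_log (max (κ ^ 2) (max (A ^ 2 / (ρ * c)) 1))
  refine ⟨A, κ * K + A + B + 1 / 2, hA0, by positivity, N, fun n hn xs m hm hcount => ?_⟩
  obtain ⟨hn1, hn2, hn3, hn4⟩ := hN n hn
  have hn0 : (0 : ℝ) < n := by
    have : 0 < n := by omega
    exact_mod_cast this
  have hlog1 : 1 ≤ Real.log n := (le_max_right _ _).trans ((le_max_right _ _).trans hn3)
  set τn := κ * Real.sqrt (Real.log n / n) with hτn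
  have hτn0 : 0 ≤ τn := by positivity
  have hτn1 : τn ≤ 1 := by
    rw [hτn, ← Real.sqrt_sq hκ0.le, ← Real.sqrt_mul (by positivity), Real.sqrt_le_one,
      ← mul_div_assoc, div_le_one hn0]
    exact (mul_le_mul_of_nonneg_right (le_max_left _ _) (by linarith)).trans hn1
  have hsq1 : (n : ℝ) * Real.sqrt (Real.log n / n) = Real.sqrt (n * Real.log n) := by
    rw [show (n : ℝ) * Real.log n = n ^ 2 * (Real.log n / n) by field_simp,
      Real.sqrt_mul (by positivity), Real.sqrt_sq hn0.le]
  have hsq2 : Real.sqrt (Real.log n / n) * Real.sqrt (n * Real.log n) = Real.log n := by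
    rw [← hsq1, mul_left_comm, Real.mul_self_sqrt (by positivity)]
    field_simp
  set mean : ℝ → ℝ := fun τ => ∑ i, tiltMean (w (xs i)) (d (xs i)) τ with hmean
  set var : ℝ → ℝ := fun τ => ∑ i, tiltVar (w (xs i)) (d (xs i)) τ with hvar
  have hderiv : ∀ τ, HasDerivAt mean (var τ) τ := fun τ =>
    HasDerivAt.fun_sum fun i _ => hasDerivAt_tiltMean _ (hw0 _) (hw _) τ
  have hvarlow : ∀ τ ∈ Set.Icc (-1 : ℝ) 1, ρ * n * c ≤ var τ := by
    intro τ hτ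
    refine (mul_le_mul_of_nonneg_right hcount hc0.le).trans ?_
    rw [Finset.sum_mul]
    refine Finset.sum_le_sum fun i _ => ?_
    split_ifs with h
    · rw [one_mul, h]
      exact hcmin τ hτ
    · rw [zero_mul]
      exact tiltVar_nonneg _ (hw0 _) (hw _) τ
  have hmean0 : mean 0 = ∑ i, ∑ y, w (xs i) y * d (xs i) y :=
    Finset.sum_congr rfl fun i _ => tiltMean_zero _ (hw _)
  rw [← hmean0] at hm
  have hcont : Continuous mean := continuous_iff_continuousAt.2 fun τ => (hderiv τ).continuousAt
  have hgrow : ∀ a b, -1 ≤ a → a ≤ b → b ≤ 1 → ρ * n * c * (b - a) ≤ mean b - mean a := by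
    intro a b ha hab hb
    refine (convex_Icc (-1 : ℝ) 1).mul_sub_le_image_sub_of_le_deriv hcont.continuousOn
      (fun τ _ => (hderiv τ).differentiableAt.differentiableWithinAt) (fun τ hτ => ?_)
      a ⟨ha, hab.trans hb⟩ b ⟨ha.trans hab, hb⟩ hab
    rw [(hderiv τ).deriv]
    exact hvarlow τ (interior_subset hτ)
  have hstep : ρ * n * c * τn = K * Real.sqrt (n * Real.log n) := by
    rw [hτn, hκ, ← hsq1]
    field_simp
  have hup := hgrow 0 τn (by norm_num) hτn0 hτn1
  have hdn := hgrow (-τn) 0 (by linarith) (by linarith) (by norm_num)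
  rw [sub_zero, hstep] at hup
  rw [zero_sub, neg_neg, hstep] at hdn
  have hmabs := abs_le.1 hm
  obtain ⟨τ, hτ, hτm⟩ : m ∈ mean '' Set.Icc (-τn) τn :=
    intermediate_value_Icc (by linarith) hcont.continuousOn ⟨by linarith, by linarith⟩
  have hτabs : |τ| ≤ τn := abs_le.2 hτ
  have hτ1 : τ ∈ Set.Icc (-1 : ℝ) 1 := ⟨by linarith [hτ.1], by linarith [hτ.2]⟩
  set s := Real.sqrt (var τ) with hs
  have hvarpos : 0 < var τ := lt_of_lt_of_le (by positivity) (hvarlow τ hτ1)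
  have hs0 : 0 < s := Real.sqrt_pos.2 hvarpos
  have hssq : s ^ 2 = var τ := Real.sq_sqrt hvarpos.le
  have hsle : s ≤ B * Real.sqrt n := by
    have h1 : var τ ≤ n * B ^ 2 := by
      have : var τ ≤ ∑ _i : Fin n, B ^ 2 :=
        Finset.sum_le_sum fun i _ => tiltVar_le _ (hw0 _) (hw _) (hd0 _) (hdB _) τ
      simpa using this
    rw [hs]
    refine Real.sqrt_le_iff.2 ⟨by positivity, ?_⟩
    rw [mul_pow, Real.sq_sqrt hn0.le]
    linarith
  have hAs : A ≤ s := by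
    refine Real.le_sqrt_of_sq_le ((le_trans ?_ (hvarlow τ hτ1)))
    have : A ^ 2 / (ρ * c) ≤ n := (le_max_left _ _).trans ((le_max_right _ _).trans hn2)
    rw [div_le_iff₀ (by positivity)] at this
    linarith
  have hwin := prodExp_window (v := fun i => tilt (w (xs i)) (d (xs i)) τ)
    (ξ := fun i y => d (xs i) y - tiltMean (w (xs i)) (d (xs i)) τ)
    (fun i => tilt_nonneg _ (hw0 _) (hw _) τ) (fun i => sum_tilt _ (hw0 _) (hw _) τ)
    (fun i => sum_tilt_centred _ (hw0 _) (hw _) τ) hs0 hssq.symm hB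
    (fun i => abs_sub_tiltMean_le _ (hw0 _) (hw _) (hd0 _) (hdB _) τ) hA0 hAs
  have hAeq : A * gaussDensity 1 - 2 * berryEsseenConst * B = 1 := by
    rw [hA, div_mul_cancel₀ _ (gaussDensity_pos 1).ne']
    ring
  simp only [Finset.sum_sub_distrib] at hwin
  rw [hAeq, show ∑ i, tiltMean (w (xs i)) (d (xs i)) τ = m from hτm] at hwin
  have hchange : Real.exp (-(τn * (K * Real.sqrt (n * Real.log n) + A))) *
        prodExp (fun i => tilt (w (xs i)) (d (xs i)) τ)
          (fun y => if -A ≤ ∑ i, d (xs i) (y i) - m ∧ ∑ i, d (xs i) (y i) - m ≤ 0 then 1 else 0)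
      ≤ prodExp (fun i => w (xs i))
        (fun y => if m - A ≤ ∑ i, d (xs i) (y i) ∧ ∑ i, d (xs i) (y i) ≤ m then 1 else 0) := by
    rw [← prodExp_const_mul]
    refine Finset.sum_le_sum fun y _ => ?_
    beta_reduce
    by_cases hy : m - A ≤ ∑ i, d (xs i) (y i) ∧ ∑ i, d (xs i) (y i) ≤ m
    · rw [if_pos hy, if_pos ⟨by linarith [hy.1], by linarith [hy.2]⟩, mul_one, mul_one]
      have hfac : ∀ i, tilt (w (xs i)) (d (xs i)) τ (y i)
          * Real.exp (τ * (tiltMean (w (xs i)) (d (xs i)) 0 - d (xs i) (y i))) ≤ w (xs i) (y i) := by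
        intro i
        rw [tiltMean_zero _ (hw _), tilt, mul_sub, Real.exp_sub, div_mul_div_comm,
          div_le_iff₀ (mul_pos (tiltZ_pos _ (hw0 _) (hw _) τ) (Real.exp_pos _))]
        have := mul_le_mul_of_nonneg_left (exp_le_tiltZ (d (xs i)) (hw0 (xs i)) (hw _) τ)
          (mul_nonneg (hw0 (xs i) (y i)) (Real.exp_nonneg (τ * d (xs i) (y i))))
        linarith
      have hprod := Finset.prod_le_prod (s := Finset.univ) (fun i _ =>
        mul_nonneg (tilt_nonneg _ (hw0 (xs i)) (hw _) τ (y i)) (Real.exp_nonneg _))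
        fun i _ => hfac i
      rw [Finset.prod_mul_distrib, ← Real.exp_sum, ← Finset.mul_sum, Finset.sum_sub_distrib]
        at hprod
      refine le_trans (mul_le_mul_of_nonneg_left (Real.exp_le_exp.2 ?_) ?_) hprod
      · change _ ≤ τ * (mean 0 - _)
        have hb : |mean 0 - ∑ i, d (xs i) (y i)| ≤ K * Real.sqrt (n * Real.log n) + A :=
          abs_le.2 ⟨by linarith [hy.2], by linarith [hy.1]⟩
        have := neg_abs_le (τ * (mean 0 - ∑ i, d (xs i) (y i)))
        rw [abs_mul] at this
        have := mul_le_mul hτabs hb (abs_nonneg _) hτn0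
        linarith
      · exact Finset.prod_nonneg fun i _ => tilt_nonneg _ (hw0 _) (hw _) τ _
    · rw [if_neg hy, if_neg fun h => hy ⟨by linarith [h.1], by linarith [h.2]⟩]
      simp
  refine le_trans ?_ hchange
  have hexp1 : τn * (K * Real.sqrt (n * Real.log n) + A) ≤ (κ * K + A) * Real.log n := by
    have e : τn * (K * Real.sqrt (n * Real.log n)) = κ * K * Real.log n := by
      rw [hτn]
      linear_combination (κ * K) * hsq2
    have h1 : τn * A ≤ Real.log n * A :=
      mul_le_mul_of_nonneg_right (hτn1.trans hlog1) hA0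
    rw [mul_add, e, add_mul, mul_comm A]
    exact add_le_add_right h1 _
  have hsexp : s ≤ Real.exp ((B + 1 / 2) * Real.log n) := by
    rw [add_mul, Real.exp_add]
    refine hsle.trans (mul_le_mul ?_ ?_ (Real.sqrt_nonneg _) (Real.exp_nonneg _))
    · have := Real.add_one_le_exp (B * Real.log n)
      have := mul_le_mul_of_nonneg_left hlog1 hB.le
      linarith
    · rw [Real.sqrt_eq_rpow, Real.rpow_def_of_pos hn0, mul_comm]
  calc Real.exp (-((κ * K + A + B + 1 / 2) * Real.log n))
      = Real.exp (-((κ * K + A) * Real.log n)) * (Real.exp ((B + 1 / 2) * Real.log n))⁻¹ := by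
        rw [← Real.exp_neg, ← Real.exp_add]
        congr 1
        ring
    _ ≤ Real.exp (-(τn * (K * Real.sqrt (n * Real.log n) + A))) * (1 / s) := by
        rw [one_div s]
        exact mul_le_mul (Real.exp_le_exp.2 (neg_le_neg hexp1)) (inv_anti₀ hs0 hsexp)
          (inv_nonneg.2 (Real.exp_nonneg _)) (Real.exp_nonneg _)
    _ ≤ _ := mul_le_mul_of_nonneg_left hwin (Real.exp_nonneg _)

lemma sub_le_mul_log_div {a b : ℝ} (ha : 0 ≤ a) (hb : 0 ≤ b) (h : b = 0 → a = 0) :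
    a - b ≤ a * Real.log (a / b) := by
  rcases ha.eq_or_lt with rfl | ha
  · simpa using hb
  have hb : 0 < b := hb.lt_of_ne' fun h' => ha.ne' (h h')
  have h1 := Real.log_le_sub_one_of_pos (div_pos hb ha)
  have h2 : Real.log (a / b) = -Real.log (b / a) := by rw [← Real.log_inv, inv_div]
  have h3 := mul_le_mul_of_nonneg_left h1 ha.le
  rw [mul_sub, mul_div_cancel₀ _ ha.ne'] at h3
  rw [h2]
  linarith

lemma sub_lt_mul_log_div {a b : ℝ} (ha : 0 ≤ a) (hb : 0 ≤ b) (h : b = 0 → a = 0) (hne : a ≠ b) :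
    a - b < a * Real.log (a / b) := by
  rcases ha.eq_or_lt with rfl | ha
  · simpa using hb.lt_of_ne hne
  have hb : 0 < b := hb.lt_of_ne' fun h' => ha.ne' (h h')
  have h1 := Real.log_lt_sub_one_of_pos (div_pos hb ha)
    (fun h => hne ((div_eq_one_iff_eq ha.ne').1 h).symm)
  have h2 : Real.log (a / b) = -Real.log (b / a) := by rw [← Real.log_inv, inv_div]
  have h3 := mul_lt_mul_of_pos_left h1 ha
  rw [mul_sub, mul_div_cancel₀ _ ha.ne'] at h3
  rw [h2]
  linarith

/-- The two-term log-sum inequality. -/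
lemma add_mul_log_div_le {a b a' b' : ℝ} (ha : 0 ≤ a) (hb : 0 ≤ b) (h : b = 0 → a = 0)
    (ha' : 0 ≤ a') (hb' : 0 ≤ b') (h' : b' = 0 → a' = 0) :
    (a + a') * Real.log ((a + a') / (b + b')) ≤
      a * Real.log (a / b) + a' * Real.log (a' / b') := by
  rcases (add_nonneg ha ha').eq_or_lt with h0 | h0
  · have e1 : a = 0 := by linarith
    have e2 : a' = 0 := by linarith
    simp [e1, e2]
  have hr : 0 < b + b' := by
    rcases (add_nonneg hb hb').eq_or_lt with h1 | h1
    · rw [h (by linarith), h' (by linarith)] at h0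
      simp at h0
    · exact h1
  set u := (a + a') / (b + b') with hu
  have hu0 : 0 < u := div_pos h0 hr
  have key : ∀ {s t : ℝ}, 0 ≤ s → 0 ≤ t → (t = 0 → s = 0) →
      s - t * u ≤ s * Real.log (s / t) - s * Real.log u := by
    intro s t hs ht hst
    refine (sub_le_mul_log_div hs (mul_nonneg ht hu0.le)
      (fun h => hst ((mul_eq_zero.1 h).resolve_right hu0.ne'))).trans (le_of_eq ?_)
    rcases hs.eq_or_lt with rfl | hs
    · simp
    have ht : t ≠ 0 := fun h => hs.ne' (hst h)
    rw [← div_div, Real.log_div (div_ne_zero hs.ne' ht) hu0.ne', mul_sub]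
  have k1 := key ha hb h
  have k2 := key ha' hb' h'
  have k3 : b * u + b' * u = a + a' := by
    rw [← add_mul, hu, mul_div_cancel₀ _ hr.ne']
  linarith

lemma deriv_nonpos_of_nonpos_right {g : ℝ → ℝ} {g' : ℝ} (hg : HasDerivAt g g' 0) (h0 : g 0 = 0)
    (h : ∀ t, 0 < t → t ≤ 1 → g t ≤ 0) : g' ≤ 0 := by
  have h1 := (hasDerivWithinAt_iff_tendsto_slope' (s := Set.Ioi (0 : ℝ)) (by simp)).1
    hg.hasDerivWithinAt
  refine le_of_tendsto h1 ?_
  filter_upwards [Ioc_mem_nhdsGT (zero_lt_one' ℝ)] with t ht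
  rw [slope_def_field, h0, sub_zero, sub_zero]
  exact div_nonpos_of_nonpos_of_nonneg (h t ht.1 ht.2) ht.1.le

section rateDistortion

variable {𝒳 𝒴 : Type} [Fintype 𝒳] [Fintype 𝒴] {p : 𝒳 → ℝ} {d : 𝒳 → 𝒴 → ℝ} {W : 𝒳 → 𝒴 → ℝ}

lemma outMarg_nonneg (hp0 : ∀ x, 0 ≤ p x) (hW : IsRChannel W) (y : 𝒴) : 0 ≤ outMarg p W y :=
  Finset.sum_nonneg fun x _ => mul_nonneg (hp0 x) (hW.1 x y)

lemma sum_outMarg (hp1 : ∑ x, p x = 1) (hW : IsRChannel W) : ∑ y, outMarg p W y = 1 := by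
  simp only [outMarg]
  rw [Finset.sum_comm]
  simp_rw [← Finset.mul_sum, hW.2, mul_one, hp1]

lemma mul_le_outMarg (hp0 : ∀ x, 0 ≤ p x) (hW : IsRChannel W) (x : 𝒳) (y : 𝒴) :
    p x * W x y ≤ outMarg p W y :=
  Finset.single_le_sum (f := fun x => p x * W x y) (fun x _ => mul_nonneg (hp0 x) (hW.1 x y))
    (Finset.mem_univ x)

lemma eq_zero_of_outMarg (hp0 : ∀ x, 0 ≤ p x) (hW : IsRChannel W) {x : 𝒳} (hx : 0 < p x) {y : 𝒴}
    (h : outMarg p W y = 0) : W x y = 0 := by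
  have h1 := mul_le_outMarg hp0 hW x y
  have h2 := mul_nonneg (hp0 x) (hW.1 x y)
  exact (mul_eq_zero.1 (le_antisymm (h ▸ h1) h2)).resolve_left hx.ne'

lemma mutualInfo_mul_log_two (p : 𝒳 → ℝ) (W : 𝒳 → 𝒴 → ℝ) : mutualInfo p W * Real.log 2 =
    ∑ x, p x * ∑ y, W x y * Real.log (W x y / outMarg p W y) := by
  have : Real.log 2 ≠ 0 := (Real.log_pos one_lt_two).ne'
  simp only [mutualInfo, Finset.sum_mul, Finset.mul_sum, Real.logb]
  refine Finset.sum_congr rfl fun x _ => Finset.sum_congr rfl fun y _ => ?_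
  field_simp

lemma mutualInfo_nonneg (hp0 : ∀ x, 0 ≤ p x) (hp1 : ∑ x, p x = 1) (hW : IsRChannel W) :
    0 ≤ mutualInfo p W := by
  refine nonneg_of_mul_nonneg_left ?_ (Real.log_pos one_lt_two)
  rw [mutualInfo_mul_log_two]
  refine Finset.sum_nonneg fun x _ => ?_
  rcases (hp0 x).eq_or_lt with h | h
  · simp [← h]
  refine mul_nonneg h.le (le_trans (le_of_eq ?_) (Finset.sum_le_sum fun y _ => sub_le_mul_log_div
    (hW.1 x y) (outMarg_nonneg hp0 hW y) (eq_zero_of_outMarg hp0 hW h)))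
  rw [Finset.sum_sub_distrib, hW.2, sum_outMarg hp1 hW, sub_self]

lemma eq_outMarg_of_mutualInfo_eq_zero (hp0 : ∀ x, 0 ≤ p x) (hp1 : ∑ x, p x = 1)
    (hW : IsRChannel W) (h0 : mutualInfo p W = 0) {x : 𝒳} (hx : 0 < p x) (y : 𝒴) :
    W x y = outMarg p W y := by
  by_contra hne
  have hle : ∀ x, 0 < p x → ∀ y, W x y - outMarg p W y ≤
      W x y * Real.log (W x y / outMarg p W y) := fun x hx y =>
    sub_le_mul_log_div (hW.1 x y) (outMarg_nonneg hp0 hW y) (eq_zero_of_outMarg hp0 hW hx)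
  have hz : ∀ x, ∑ y, (W x y - outMarg p W y) = 0 := fun x => by
    rw [Finset.sum_sub_distrib, hW.2, sum_outMarg hp1 hW, sub_self]
  have h1 := mutualInfo_mul_log_two p W
  rw [h0, zero_mul] at h1
  refine lt_irrefl (0 : ℝ) (lt_of_lt_of_eq ?_ h1.symm)
  refine Finset.sum_pos' (fun x _ => ?_) ⟨x, Finset.mem_univ x, mul_pos hx ?_⟩
  · rcases (hp0 x).eq_or_lt with h | h
    · simp [← h]
    · exact mul_nonneg h.le (le_of_eq_of_le (hz x).symm (Finset.sum_le_sum fun y _ => hle x h y))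
  · exact lt_of_eq_of_lt (hz x).symm (Finset.sum_lt_sum (fun y _ => hle x hx y)
      ⟨y, Finset.mem_univ y, sub_lt_mul_log_div (hW.1 x y) (outMarg_nonneg hp0 hW y)
        (eq_zero_of_outMarg hp0 hW hx) hne⟩)

/-- Mutual information is at most the average divergence to any reference output law. -/
lemma mutualInfo_mul_log_two_le (hp0 : ∀ x, 0 ≤ p x) (hp1 : ∑ x, p x = 1) (hW : IsRChannel W)
    {q : 𝒴 → ℝ} (hq0 : ∀ y, 0 ≤ q y) (hq1 : ∑ y, q y = 1) (hq : ∀ y, q y = 0 → outMarg p W y = 0) :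
    mutualInfo p W * Real.log 2 ≤ ∑ x, p x * ∑ y, W x y * Real.log (W x y / q y) := by
  have h0 : 0 ≤ ∑ y, outMarg p W y * Real.log (outMarg p W y / q y) := by
    refine le_trans (le_of_eq ?_) (Finset.sum_le_sum fun y _ =>
      sub_le_mul_log_div (outMarg_nonneg hp0 hW y) (hq0 y) (hq y))
    rw [Finset.sum_sub_distrib, hq1, sum_outMarg hp1 hW, sub_self]
  have h1 : ∑ y, outMarg p W y * Real.log (outMarg p W y / q y) =
      ∑ x, p x * ∑ y, W x y * Real.log (outMarg p W y / q y) := by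
    simp only [Finset.mul_sum]
    rw [Finset.sum_comm]
    refine Finset.sum_congr rfl fun y _ => ?_
    simp only [outMarg, Finset.sum_mul, mul_assoc]
  rw [mutualInfo_mul_log_two]
  refine (le_add_of_nonneg_right (h1 ▸ h0)).trans (le_of_eq ?_)
  rw [← Finset.sum_add_distrib]
  refine Finset.sum_congr rfl fun x _ => ?_
  rcases (hp0 x).eq_or_lt with h | h
  · simp [← h]
  rw [← mul_add, ← Finset.sum_add_distrib]
  congr 1
  refine Finset.sum_congr rfl fun y _ => ?_
  by_cases hxy : W x y = 0
  · simp [hxy]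
  have ho : outMarg p W y ≠ 0 := fun h' => hxy (eq_zero_of_outMarg hp0 hW h h')
  have hqy : q y ≠ 0 := fun h' => ho (hq y h')
  rw [← mul_add, ← Real.log_mul (div_ne_zero hxy ho) (div_ne_zero ho hqy),
    div_mul_div_cancel₀ ho]

lemma mutualInfo_mix_le (hp0 : ∀ x, 0 ≤ p x) {W' : 𝒳 → 𝒴 → ℝ} (hW : IsRChannel W)
    (hW' : IsRChannel W') {t : ℝ} (ht0 : 0 < t) (ht1 : t < 1) :
    mutualInfo p (fun x y => (1 - t) * W x y + t * W' x y) ≤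
      (1 - t) * mutualInfo p W + t * mutualInfo p W' := by
  have hl : 0 < Real.log 2 := Real.log_pos one_lt_two
  have hs : 0 < 1 - t := by linarith
  refine le_of_mul_le_mul_right ?_ hl
  rw [add_mul, mul_assoc, mul_assoc]
  simp only [mutualInfo_mul_log_two]
  rw [Finset.mul_sum, Finset.mul_sum, ← Finset.sum_add_distrib]
  refine Finset.sum_le_sum fun x _ => ?_
  rcases (hp0 x).eq_or_lt with h | h
  · simp [← h]
  rw [mul_left_comm, mul_left_comm t, ← mul_add]
  refine mul_le_mul_of_nonneg_left ?_ h.le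
  rw [Finset.mul_sum, Finset.mul_sum, ← Finset.sum_add_distrib]
  refine Finset.sum_le_sum fun y _ => ?_
  have ho : outMarg p (fun x y => (1 - t) * W x y + t * W' x y) y =
      (1 - t) * outMarg p W y + t * outMarg p W' y := by
    simp only [outMarg, Finset.mul_sum, ← Finset.sum_add_distrib]
    exact Finset.sum_congr rfl fun x _ => by ring
  rw [ho]
  refine (add_mul_log_div_le (mul_nonneg hs.le (hW.1 x y))
    (mul_nonneg hs.le (outMarg_nonneg hp0 hW y)) (fun h' => ?_) (mul_nonneg ht0.le (hW'.1 x y))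
    (mul_nonneg ht0.le (outMarg_nonneg hp0 hW' y)) (fun h' => ?_)).trans (le_of_eq ?_)
  · rw [eq_zero_of_outMarg hp0 hW h ((mul_eq_zero.1 h').resolve_left hs.ne'), mul_zero]
  · rw [eq_zero_of_outMarg hp0 hW' h ((mul_eq_zero.1 h').resolve_left ht0.ne'), mul_zero]
  · rw [mul_div_mul_left _ _ hs.ne', mul_div_mul_left _ _ ht0.ne', mul_assoc, mul_assoc]

lemma RDfun_le (hp0 : ∀ x, 0 ≤ p x) (hp1 : ∑ x, p x = 1) (hW : IsRChannel W) {D : ℝ}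
    (hD : expDist p d W ≤ D) : RDfun p d D ≤ mutualInfo p W := by
  refine csInf_le ⟨0, ?_⟩ ⟨W, hW, hD, rfl⟩
  rintro r ⟨V, hV, -, rfl⟩
  exact mutualInfo_nonneg hp0 hp1 hV

lemma expDist_mix (t : ℝ) (W' : 𝒳 → 𝒴 → ℝ) :
    expDist p d (fun x y => (1 - t) * W x y + t * W' x y) =
      (1 - t) * expDist p d W + t * expDist p d W' := by
  simp only [expDist, Finset.mul_sum, ← Finset.sum_add_distrib]
  exact Finset.sum_congr rfl fun x _ => Finset.sum_congr rfl fun y _ => by ring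

/-- The tangent line to the rate-distortion function supports all rate-distortion pairs. -/
lemma RDfun_tangent (hp0 : ∀ x, 0 ≤ p x) (hp1 : ∑ x, p x = 1) {D : ℝ} {Wstar : 𝒳 → 𝒴 → ℝ}
    (hWch : IsRChannel Wstar) (hWfeas : expDist p d Wstar ≤ D)
    (hWopt : mutualInfo p Wstar = RDfun p d D) (hdiff : DifferentiableAt ℝ (RDfun p d) D)
    (hW : IsRChannel W) :
    deriv (RDfun p d) D * (expDist p d W - D) ≤ mutualInfo p W - RDfun p d D := by
  set E := expDist p d W
  have h1 : HasDerivAt (fun t : ℝ => D + t * (E - D)) (E - D) 0 := by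
    simpa using ((hasDerivAt_id (0 : ℝ)).mul_const (E - D)).const_add D
  have h2 : HasDerivAt (fun t : ℝ => RDfun p d (D + t * (E - D)))
      (deriv (RDfun p d) D * (E - D)) 0 := by
    refine HasDerivAt.comp (h₂ := RDfun p d) 0 ?_ h1
    simpa using hdiff.hasDerivAt
  have h3 : HasDerivAt (fun t : ℝ => RDfun p d D + t * (mutualInfo p W - RDfun p d D))
      (mutualInfo p W - RDfun p d D) 0 := by
    simpa using ((hasDerivAt_id (0 : ℝ)).mul_const
      (mutualInfo p W - RDfun p d D)).const_add (RDfun p d D)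
  refine sub_nonpos.1 (deriv_nonpos_of_nonpos_right (h2.sub h3) (by simp) fun t ht0 ht1 => ?_)
  simp only [Pi.sub_apply]
  rw [sub_nonpos]
  rcases ht1.eq_or_lt with rfl | ht1
  · simpa [E] using RDfun_le (d := d) hp0 hp1 hW le_rfl
  have hmix := mutualInfo_mix_le hp0 hWch hW ht0 ht1
  refine (RDfun_le hp0 hp1 (W := fun x y => (1 - t) * Wstar x y + t * W x y) ⟨fun x y => ?_,
    fun x => ?_⟩ ?_).trans (hmix.trans (le_of_eq ?_))
  · exact add_nonneg (mul_nonneg (by linarith) (hWch.1 x y)) (mul_nonneg ht0.le (hW.1 x y))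
  · rw [Finset.sum_add_distrib, ← Finset.mul_sum, ← Finset.mul_sum, hWch.2, hW.2]
    ring
  · rw [expDist_mix]
    have := mul_le_mul_of_nonneg_left hWfeas (by linarith : 0 ≤ 1 - t)
    simp only [E]
    linarith
  · rw [hWopt]
    ring

end rateDistortion

section kkt

variable {𝒳 𝒴 : Type} [Fintype 𝒳] [Fintype 𝒴] {p : 𝒳 → ℝ} {d : 𝒳 → 𝒴 → ℝ} {D : ℝ}

lemma lt_expDist_const (hDmax : ∀ y : 𝒴, D < ∑ x, p x * d x y) {W : 𝒳 → 𝒴 → ℝ} {q : 𝒴 → ℝ}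
    (hp0 : ∀ x, 0 ≤ p x) (hq0 : ∀ y, 0 ≤ q y) (hq1 : ∑ y, q y = 1)
    (h : ∀ x, 0 < p x → ∀ y, W x y = q y) : D < expDist p d W := by
  have e : expDist p d W = ∑ y, q y * ∑ x, p x * d x y := by
    simp only [expDist, Finset.mul_sum]
    rw [Finset.sum_comm]
    refine Finset.sum_congr rfl fun y _ => Finset.sum_congr rfl fun x _ => ?_
    rcases (hp0 x).eq_or_lt with hx | hx
    · simp [← hx]
    · rw [h x hx]
      ring
  have e' : D = ∑ y, q y * D := by rw [← Finset.sum_mul, hq1, one_mul]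
  rw [e, e']
  obtain ⟨y, -, hy⟩ := Finset.exists_ne_zero_of_sum_ne_zero (hq1.trans_ne one_ne_zero)
  exact Finset.sum_lt_sum (fun y _ => mul_le_mul_of_nonneg_left (hDmax y).le (hq0 y))
    ⟨y, Finset.mem_univ y, mul_lt_mul_of_pos_left (hDmax y) ((hq0 y).lt_of_ne' hy)⟩

lemma RDfun_pos (hp0 : ∀ x, 0 ≤ p x) (hp1 : ∑ x, p x = 1) (hDmax : ∀ y : 𝒴, D < ∑ x, p x * d x y)
    {Wstar : 𝒳 → 𝒴 → ℝ} (hWch : IsRChannel Wstar) (hWfeas : expDist p d Wstar ≤ D)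
    (hWopt : mutualInfo p Wstar = RDfun p d D) : 0 < RDfun p d D := by
  rw [← hWopt]
  refine (mutualInfo_nonneg hp0 hp1 hWch).lt_of_ne' fun h => ?_
  exact (lt_expDist_const hDmax hp0 (outMarg_nonneg hp0 hWch) (sum_outMarg hp1 hWch)
    fun x hx y => eq_outMarg_of_mutualInfo_eq_zero hp0 hp1 hWch h hx y).not_ge hWfeas

lemma deriv_RDfun_neg [Nonempty 𝒴] (hp0 : ∀ x, 0 ≤ p x) (hp1 : ∑ x, p x = 1)
    (hDmax : ∀ y : 𝒴, D < ∑ x, p x * d x y) {Wstar : 𝒳 → 𝒴 → ℝ}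
    (hWch : IsRChannel Wstar) (hWfeas : expDist p d Wstar ≤ D)
    (hWopt : mutualInfo p Wstar = RDfun p d D) (hdiff : DifferentiableAt ℝ (RDfun p d) D) :
    deriv (RDfun p d) D < 0 := by
  classical
  obtain ⟨y₀⟩ := ‹Nonempty 𝒴›
  obtain ⟨q, hq⟩ : ∃ q : 𝒴 → ℝ, q = fun y => if y = y₀ then 1 else 0 := ⟨_, rfl⟩
  have hq0 : ∀ y, 0 ≤ q y := fun y => by
    rw [hq]
    dsimp only
    split_ifs <;> norm_num
  have hq1 : ∑ y, q y = 1 := by simp [hq]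
  have hV : IsRChannel (fun _ : 𝒳 => q) := ⟨fun _ => hq0, fun _ => hq1⟩
  have ho : outMarg p (fun _ : 𝒳 => q) = q := by
    funext y
    rw [outMarg, ← Finset.sum_mul, hp1, one_mul]
  have hI : mutualInfo p (fun _ : 𝒳 => q) = 0 := by
    rw [mutualInfo, ho]
    refine Finset.sum_eq_zero fun x _ => Finset.sum_eq_zero fun y _ => ?_
    by_cases hy : q y = 0
    · simp [hy]
    · simp [div_self hy]
  have hE := lt_expDist_const hDmax hp0 hq0 hq1 (W := fun _ : 𝒳 => q) (fun _ _ _ => rfl)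
  have ht := RDfun_tangent hp0 hp1 hWch hWfeas hWopt hdiff hV
  rw [hI] at ht
  have hR := RDfun_pos hp0 hp1 hDmax hWch hWfeas hWopt
  by_contra hcon
  have := mul_nonneg (not_lt.1 hcon) (sub_nonneg.2 hE.le)
  linarith

/-- Dual bound for an arbitrary reference output law. -/
lemma RDfun_le_dual (hp0 : ∀ x, 0 ≤ p x) (hp1 : ∑ x, p x = 1) {Wstar : 𝒳 → 𝒴 → ℝ}
    (hWch : IsRChannel Wstar) (hWfeas : expDist p d Wstar ≤ D)
    (hWopt : mutualInfo p Wstar = RDfun p d D) (hdiff : DifferentiableAt ℝ (RDfun p d) D)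
    {θ : ℝ} (hθ : θ = -deriv (RDfun p d) D * Real.log 2)
    {q : 𝒴 → ℝ} (hq0 : ∀ y, 0 ≤ q y) (hq1 : ∑ y, q y = 1) :
    RDfun p d D * Real.log 2 + θ * D ≤ -∑ x, p x * Real.log (tiltZ q (d x) (-θ)) := by
  have hl : 0 < Real.log 2 := Real.log_pos one_lt_two
  have hZ : ∀ x, 0 < tiltZ q (d x) (-θ) := fun x => tiltZ_pos _ hq0 hq1 _
  have hV : IsRChannel (fun x => tilt q (d x) (-θ)) :=
    ⟨fun x y => tilt_nonneg _ hq0 hq1 _ y, fun x => sum_tilt _ hq0 hq1 _⟩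
  have ht := RDfun_tangent hp0 hp1 hWch hWfeas hWopt hdiff hV
  have hI := mutualInfo_mul_log_two_le hp0 hp1 hV hq0 hq1 (fun y hy => by
    simp [outMarg, tilt, hy])
  have e : ∑ x, p x * ∑ y, tilt q (d x) (-θ) y * Real.log (tilt q (d x) (-θ) y / q y) =
      -θ * expDist p d (fun x => tilt q (d x) (-θ)) -
        ∑ x, p x * Real.log (tiltZ q (d x) (-θ)) := by
    rw [expDist, Finset.mul_sum, ← Finset.sum_sub_distrib]
    refine Finset.sum_congr rfl fun x _ => ?_
    have : ∀ y, tilt q (d x) (-θ) y * Real.log (tilt q (d x) (-θ) y / q y) =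
        -θ * (tilt q (d x) (-θ) y * d x y) -
          tilt q (d x) (-θ) y * Real.log (tiltZ q (d x) (-θ)) := by
      intro y
      by_cases hy : q y = 0
      · simp [tilt, hy]
      have : tilt q (d x) (-θ) y / q y = Real.exp (-θ * d x y) / tiltZ q (d x) (-θ) := by
        rw [tilt]
        field_simp
      rw [this, Real.log_div (Real.exp_pos _).ne' (hZ x).ne', Real.log_exp]
      ring
    simp_rw [this]
    rw [Finset.sum_sub_distrib, ← Finset.sum_mul, sum_tilt _ hq0 hq1, one_mul, mul_sub,
      ← Finset.mul_sum, mul_left_comm]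
    simp_rw [mul_assoc, ← Finset.mul_sum]
  rw [e] at hI
  have h2 := mul_le_mul_of_nonneg_right ht hl.le
  have h3 : deriv (RDfun p d) D * (expDist p d (fun x => tilt q (d x) (-θ)) - D) * Real.log 2 =
      -θ * (expDist p d (fun x => tilt q (d x) (-θ)) - D) := by
    rw [hθ]
    ring
  rw [h3, sub_mul] at h2
  linarith

/-- The optimality conditions for the rate-distortion problem, in natural units. -/
lemma rateDistortion_optimality [Nonempty 𝒴] (hp0 : ∀ x, 0 ≤ p x) (hp1 : ∑ x, p x = 1)
    (hDmax : ∀ y : 𝒴, D < ∑ x, p x * d x y) {Wstar : 𝒳 → 𝒴 → ℝ}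
    (hWch : IsRChannel Wstar) (hWfeas : expDist p d Wstar ≤ D)
    (hWopt : mutualInfo p Wstar = RDfun p d D) (hdiff : DifferentiableAt ℝ (RDfun p d) D) :
    ∃ θ : ℝ, 0 < θ ∧ ∃ ι : 𝒳 → ℝ,
      (∀ x, DtiltedInfo p d D (outMarg p Wstar) x * Real.log 2 = ι x) ∧
      (∀ x, ∑ y, outMarg p Wstar y * Real.exp (θ * (D - d x y) + ι x) = 1) ∧
      ∑ x, p x * ι x = RDfun p d D * Real.log 2 ∧
      ∑ x, p x * ∑ y, outMarg p Wstar y * Real.exp (θ * (D - d x y) + ι x) * d x y = D ∧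
      (∀ y, ∑ x, p x * Real.exp (θ * (D - d x y) + ι x) ≤ 1) ∧
      ∃ x₀ y₁ y₂, 0 < p x₀ ∧ 0 < outMarg p Wstar y₁ ∧ 0 < outMarg p Wstar y₂ ∧
        d x₀ y₁ ≠ d x₀ y₂ := by
  classical
  have hl : 0 < Real.log 2 := Real.log_pos one_lt_two
  set q := outMarg p Wstar with hq
  have hq0 : ∀ y, 0 ≤ q y := outMarg_nonneg hp0 hWch
  have hq1 : ∑ y, q y = 1 := sum_outMarg hp1 hWch
  obtain ⟨θ, hθ⟩ : ∃ θ, θ = -deriv (RDfun p d) D * Real.log 2 := ⟨_, rfl⟩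
  have hθ0 : 0 < θ := by
    rw [hθ]
    exact mul_pos (neg_pos.2 (deriv_RDfun_neg hp0 hp1 hDmax hWch hWfeas hWopt hdiff)) hl
  have hZ : ∀ x, 0 < tiltZ q (d x) (-θ) := fun x => tiltZ_pos _ hq0 hq1 _
  have hdual := fun {q' : 𝒴 → ℝ} => RDfun_le_dual hp0 hp1 hWch hWfeas hWopt hdiff hθ (q := q')
  set ι : 𝒳 → ℝ := fun x => -θ * D - Real.log (tiltZ q (d x) (-θ)) with hι
  have hw : ∀ x y, Real.exp (θ * (D - d x y) + ι x) =
      Real.exp (-θ * d x y) / tiltZ q (d x) (-θ) := by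
    intro x y
    rw [hι, show θ * (D - d x y) + (-θ * D - Real.log (tiltZ q (d x) (-θ))) =
      -θ * d x y - Real.log (tiltZ q (d x) (-θ)) by ring, Real.exp_sub, Real.exp_log (hZ x)]
  have htilt : ∀ x y, q y * Real.exp (θ * (D - d x y) + ι x) = tilt q (d x) (-θ) y := by
    intro x y
    rw [hw, tilt, mul_div_assoc]
  have hsupp : ∀ x, 0 < p x → ∀ y, q y = 0 → Wstar x y = 0 := fun x hx y hy =>
    eq_zero_of_outMarg hp0 hWch hx hy
  have hgap : ∑ x, p x * ∑ y, (Wstar x y * Real.log (Wstar x y / tilt q (d x) (-θ) y)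
        - (Wstar x y - tilt q (d x) (-θ) y)) =
      RDfun p d D * Real.log 2 + θ * expDist p d Wstar +
        ∑ x, p x * Real.log (tiltZ q (d x) (-θ)) := by
    rw [← hWopt, mutualInfo_mul_log_two, expDist, Finset.mul_sum, ← Finset.sum_add_distrib,
      ← Finset.sum_add_distrib]
    refine Finset.sum_congr rfl fun x _ => ?_
    rcases (hp0 x).eq_or_lt with hx | hx
    · simp [← hx]
    have : ∀ y, Wstar x y * Real.log (Wstar x y / tilt q (d x) (-θ) y) =
        Wstar x y * Real.log (Wstar x y / q y) + θ * (Wstar x y * d x y) +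
          Wstar x y * Real.log (tiltZ q (d x) (-θ)) := by
      intro y
      by_cases hxy : Wstar x y = 0
      · simp [hxy]
      have hqy : q y ≠ 0 := fun h => hxy (hsupp x hx y h)
      rw [tilt, Real.log_div hxy (div_ne_zero (mul_ne_zero hqy (Real.exp_pos _).ne') (hZ x).ne'),
        Real.log_div (mul_ne_zero hqy (Real.exp_pos _).ne') (hZ x).ne',
        Real.log_mul hqy (Real.exp_pos _).ne', Real.log_exp, Real.log_div hxy hqy]
      ring
    simp_rw [this]
    rw [Finset.sum_sub_distrib, Finset.sum_sub_distrib, hWch.2, sum_tilt _ hq0 hq1, sub_self,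
      sub_zero, Finset.sum_add_distrib, Finset.sum_add_distrib, ← Finset.sum_mul, hWch.2, one_mul,
      mul_add, mul_add, ← Finset.mul_sum, mul_left_comm (p x) θ]
    simp_rw [mul_assoc, ← Finset.mul_sum, ← hq]
  have hterm : ∀ x, 0 < p x → ∀ y, 0 ≤ Wstar x y * Real.log (Wstar x y / tilt q (d x) (-θ) y)
        - (Wstar x y - tilt q (d x) (-θ) y) := fun x hx y =>
    sub_nonneg.2 (sub_le_mul_log_div (hWch.1 x y) (tilt_nonneg _ hq0 hq1 _ y) fun h => by
      refine hsupp x hx y ?_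
      rw [← htilt] at h
      exact (mul_eq_zero.1 h).resolve_right (Real.exp_pos _).ne')
  have hrow : ∀ x, 0 ≤ p x * ∑ y, (Wstar x y * Real.log (Wstar x y / tilt q (d x) (-θ) y)
        - (Wstar x y - tilt q (d x) (-θ) y)) := by
    intro x
    rcases (hp0 x).eq_or_lt with hx | hx
    · simp [← hx]
    · exact mul_nonneg hx.le (Finset.sum_nonneg fun y _ => hterm x hx y)
  have hge := Finset.sum_nonneg fun x (_ : x ∈ Finset.univ) => hrow x
  have hle := hdual hq0 hq1
  have hfeas' := mul_le_mul_of_nonneg_left hWfeas hθ0.le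
  have hE : expDist p d Wstar = D :=
    le_antisymm hWfeas (le_of_mul_le_mul_left (by linarith) hθ0)
  have hlogZ : ∑ x, p x * Real.log (tiltZ q (d x) (-θ)) =
      -(RDfun p d D * Real.log 2 + θ * D) := by linarith
  have hgap0 : ∑ x, p x * ∑ y, (Wstar x y * Real.log (Wstar x y / tilt q (d x) (-θ) y)
        - (Wstar x y - tilt q (d x) (-θ) y)) = 0 := by
    rw [hgap, hlogZ, hE]
    ring
  have hWeq : ∀ x, 0 < p x → ∀ y, Wstar x y = tilt q (d x) (-θ) y := by
    intro x hx y
    by_contra hne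
    have h1 := (Finset.sum_eq_zero_iff_of_nonneg (fun x _ => hrow x)).1 hgap0 x (Finset.mem_univ x)
    have h2 := (Finset.sum_eq_zero_iff_of_nonneg (fun y _ => hterm x hx y)).1
      ((mul_eq_zero.1 h1).resolve_left hx.ne') y (Finset.mem_univ y)
    have h3 := sub_lt_mul_log_div (hWch.1 x y) (tilt_nonneg (d x) hq0 hq1 (-θ) y) (fun h => by
      refine hsupp x hx y ?_
      rw [← htilt] at h
      exact (mul_eq_zero.1 h).resolve_right (Real.exp_pos _).ne') hne
    linarith
  refine ⟨θ, hθ0, ι, fun x => ?_, fun x => ?_, ?_, ?_, fun y => ?_, ?_⟩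
  · have e : ∑ y, q y * (2 : ℝ) ^ (-deriv (RDfun p d) D * (D - d x y)) =
        Real.exp (θ * D) * tiltZ q (d x) (-θ) := by
      rw [tiltZ, Finset.mul_sum]
      refine Finset.sum_congr rfl fun y _ => ?_
      rw [Real.rpow_def_of_pos two_pos, mul_left_comm (Real.exp _), ← Real.exp_add, hθ]
      congr 2
      ring
    rw [DtiltedInfo, e, Real.logb, neg_mul, div_mul_cancel₀ _ hl.ne',
      Real.log_mul (Real.exp_pos _).ne' (hZ x).ne', Real.log_exp, hι]
    ring
  · simp_rw [htilt]
    exact sum_tilt _ hq0 hq1 _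
  · simp only [hι, mul_sub, Finset.sum_sub_distrib, hlogZ]
    rw [← Finset.sum_mul, hp1]
    ring
  · refine Eq.trans ?_ hE
    refine Finset.sum_congr rfl fun x _ => ?_
    rcases (hp0 x).eq_or_lt with hx | hx
    · simp [← hx]
    rw [Finset.mul_sum]
    refine Finset.sum_congr rfl fun y _ => ?_
    rw [htilt, hWeq x hx, mul_assoc]
  · simp_rw [hw]
    have hderiv : HasDerivAt (fun t : ℝ => ∑ x, p x * Real.log
          ((1 - t) * tiltZ q (d x) (-θ) + t * Real.exp (-θ * d x y)) -
          ∑ x, p x * Real.log (tiltZ q (d x) (-θ)))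
        (∑ x, p x * ((Real.exp (-θ * d x y) - tiltZ q (d x) (-θ)) / tiltZ q (d x) (-θ))) 0 := by
      refine HasDerivAt.sub_const _ (HasDerivAt.fun_sum fun x _ => HasDerivAt.const_mul _ ?_)
      have h1 : HasDerivAt (fun t : ℝ => (1 - t) * tiltZ q (d x) (-θ) + t * Real.exp (-θ * d x y))
          (Real.exp (-θ * d x y) - tiltZ q (d x) (-θ)) 0 := by
        refine ((((hasDerivAt_id (0 : ℝ)).const_sub 1).mul_const _).add
          ((hasDerivAt_id (0 : ℝ)).mul_const _)).congr_deriv ?_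
        ring
      refine (h1.log (by simpa using (hZ x).ne')).congr_deriv ?_
      simp
    have hle0 := deriv_nonpos_of_nonpos_right hderiv (by simp) fun t ht0 ht1 => ?_
    · simp_rw [sub_div, div_self (hZ _).ne', mul_sub, mul_one, Finset.sum_sub_distrib, hp1] at hle0
      linarith
    · have h1 := hdual (q' := fun y' => (1 - t) * q y' + t * if y' = y then 1 else 0)
        (fun y' => add_nonneg (mul_nonneg (by linarith) (hq0 y'))
          (mul_nonneg ht0.le (by split_ifs <;> norm_num)))
        (by
          rw [Finset.sum_add_distrib, ← Finset.mul_sum, ← Finset.mul_sum, hq1]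
          simp)
      have h2 : ∀ x, tiltZ (fun y' => (1 - t) * q y' + t * if y' = y then 1 else 0) (d x) (-θ) =
          (1 - t) * tiltZ q (d x) (-θ) + t * Real.exp (-θ * d x y) := by
        intro x
        simp only [tiltZ, add_mul, Finset.sum_add_distrib, Finset.mul_sum, mul_assoc]
        simp
      simp_rw [h2] at h1
      linarith
  · by_contra! hcon
    refine (lt_expDist_const hDmax hp0 hq0 hq1 (W := Wstar) fun x hx y => ?_).not_ge hWfeas
    obtain ⟨y₀, -, hy₀⟩ := Finset.exists_ne_zero_of_sum_ne_zero (hq1.trans_ne one_ne_zero)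
    have hy₀ : 0 < q y₀ := (hq0 y₀).lt_of_ne' hy₀
    have hconst : ∀ y, q y * Real.exp (-θ * d x y) = q y * Real.exp (-θ * d x y₀) := by
      intro y
      rcases (hq0 y).eq_or_lt with h | h
      · simp [← h]
      · rw [hcon x y y₀ hx h hy₀]
    rw [hWeq x hx, tilt, hconst, tiltZ]
    simp_rw [hconst]
    rw [← Finset.sum_mul, hq1, one_mul, mul_div_cancel_right₀ _ (Real.exp_pos _).ne']

end kkt

section iidTail

variable {𝒳 : Type} [Fintype 𝒳] {p ι : 𝒳 → ℝ} {μ σ : ℝ}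

lemma exists_forall_le_sqrt (K : ℝ) : ∃ N : ℕ, ∀ n : ℕ, N ≤ n →
    K ≤ Real.sqrt n ∧ 1 ≤ Real.log n ∧ 3 ≤ n := by
  obtain ⟨N, hN⟩ := exists_forall_ge_log (max (K ^ 2) 1)
  refine ⟨N, fun n hn => ?_⟩
  obtain ⟨-, h2, h3, h4⟩ := hN n hn
  exact ⟨Real.le_sqrt_of_sq_le ((le_max_left _ _).trans h2), (le_max_right _ _).trans h3, h4⟩

/-- Upper tail of a sum of i.i.d. variables, with a logarithmic shift absorbing an error of order
`n ^ (-1 / 2)`. -/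
lemma exists_iid_upper_tail (hp0 : ∀ x, 0 ≤ p x) (hp1 : ∑ x, p x = 1)
    (hμ : ∑ x, p x * ι x = μ) (hσ0 : 0 ≤ σ) (hσ : ∑ x, p x * (ι x - μ) ^ 2 = σ ^ 2)
    {z : ℝ} (hz : 0 < Qfun z) {K : ℝ} (hK : 0 ≤ K) :
    ∃ C : ℝ, 0 ≤ C ∧ ∃ N : ℕ, ∀ n : ℕ, N ≤ n →
      prodExp (fun _ : Fin n => p) (fun x => if μ * n + σ * Real.sqrt n * z + C * Real.log n ≤
        ∑ i, ι (x i) then 1 else 0) ≤ Qfun z - K / Real.sqrt n := by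
  rcases hσ0.eq_or_lt with h0 | h0
  · obtain ⟨N, hN⟩ := exists_forall_le_sqrt (K / Qfun z)
    refine ⟨1, zero_le_one, N, fun n hn => ?_⟩
    obtain ⟨h1, h2, h3⟩ := hN n hn
    have hn0 : (0 : ℝ) < n := by
      have : 0 < n := by omega
      exact_mod_cast this
    have hpt : ∀ x, p x ≠ 0 → ι x = μ := by
      intro x hx
      rw [← h0, zero_pow two_ne_zero] at hσ
      have := (Finset.sum_eq_zero_iff_of_nonneg
        (fun x _ => mul_nonneg (hp0 x) (sq_nonneg (ι x - μ)))).1 hσ x (Finset.mem_univ x)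
      exact sub_eq_zero.1 (pow_eq_zero_iff two_ne_zero |>.1 ((mul_eq_zero.1 this).resolve_left hx))
    have hzero : prodExp (fun _ : Fin n => p) (fun x => if μ * n + σ * Real.sqrt n * z +
        1 * Real.log n ≤ ∑ i, ι (x i) then 1 else 0) = 0 := by
      refine Finset.sum_eq_zero fun x _ => ?_
      beta_reduce
      by_cases hx : ∏ i, p (x i) = 0
      · rw [hx, zero_mul]
      · have : ∑ i, ι (x i) = n * μ := by
          rw [Finset.sum_congr rfl fun i _ => hpt (x i) (Finset.prod_ne_zero_iff.1 hx i
            (Finset.mem_univ i))]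
          simp
        rw [this, ← h0, if_neg (by linarith), mul_zero]
    rw [hzero]
    have hs : 0 < Real.sqrt n := Real.sqrt_pos.2 hn0
    rw [div_le_iff₀ hz] at h1
    rw [sub_nonneg, div_le_iff₀ hs]
    linarith
  · set B := ∑ x, |ι x - μ| + 1 with hB
    have hB0 : 0 < B := by positivity
    have hιB : ∀ x, |ι x - μ| ≤ B := fun x =>
      (Finset.single_le_sum (f := fun x => |ι x - μ|) (fun x _ => abs_nonneg _)
        (Finset.mem_univ x)).trans (by linarith)
    set m := gaussDensity (|z| + 1) with hm
    have hm0 : 0 < m := gaussDensity_pos _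
    set a := (berryEsseenConst * (B / σ) + K) / m with ha
    have ha0 : 0 ≤ a := by
      have := berryEsseenConst_pos
      positivity
    obtain ⟨N, hN⟩ := exists_forall_le_sqrt a
    refine ⟨σ * a, by positivity, N, fun n hn => ?_⟩
    obtain ⟨h1, h2, h3⟩ := hN n hn
    have hn0 : (0 : ℝ) < n := by
      have : 0 < n := by omega
      exact_mod_cast this
    have hs : 0 < Real.sqrt n := Real.sqrt_pos.2 hn0
    have hcent : ∑ x, p x * (ι x - μ) = 0 := by
      simp_rw [mul_sub]
      rw [Finset.sum_sub_distrib, ← Finset.sum_mul, hμ, hp1, one_mul, sub_self]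
    have hbe := berryEsseen_upper (n := n) (v := fun _ => p) (ξ := fun _ x => ι x - μ)
      (fun _ => hp0) (fun _ => hp1) (fun _ => hcent) (s := σ * Real.sqrt n) (by positivity)
      (by
        rw [Finset.sum_const, hσ, mul_pow, Real.sq_sqrt hn0.le]
        simp [mul_comm]) hB0 (fun _ => hιB) (z + a / Real.sqrt n)
    have ha1 : a / Real.sqrt n ≤ 1 := (div_le_one hs).2 h1
    have hq := le_Qfun_sub (a := z) (b := z + a / Real.sqrt n) (m := m)
      (le_add_of_nonneg_right (by positivity)) (fun t ht => gaussDensity_le_of_abs_le (by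
        rw [abs_of_nonneg (by positivity : 0 ≤ |z| + 1), abs_le]
        exact ⟨by linarith [ht.1, neg_abs_le z], by linarith [ht.2, le_abs_self z]⟩))
    have e1 : (z + a / Real.sqrt n - z) * m =
        berryEsseenConst * (B / (σ * Real.sqrt n)) + K / Real.sqrt n := by
      rw [add_sub_cancel_left, ha]
      field_simp
    have hle : prodExp (fun _ : Fin n => p) (fun x => if μ * n + σ * Real.sqrt n * z +
        σ * a * Real.log n ≤ ∑ i, ι (x i) then 1 else 0) ≤
        prodExp (fun _ : Fin n => p) (fun x => if σ * Real.sqrt n * (z + a / Real.sqrt n) ≤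
          ∑ i, (ι (x i) - μ) then 1 else 0) := by
      refine prodExp_mono (fun _ => hp0) fun x => ?_
      split_ifs with hx hy
      · exact le_rfl
      · refine absurd ?_ hy
        have e2 : σ * Real.sqrt n * (z + a / Real.sqrt n) = σ * Real.sqrt n * z + σ * a := by
          field_simp
        have e3 : σ * a ≤ σ * a * Real.log n := le_mul_of_one_le_right (by positivity) h2
        rw [e2, Finset.sum_sub_distrib]
        simp only [Finset.sum_const, Finset.card_univ, Fintype.card_fin, nsmul_eq_mul]
        linarith
      · exact zero_le_one
      · exact le_rfl
    linarith

/-- Lower bound for the upper tail of a sum of i.i.d. variables. -/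
lemma exists_iid_upper_tail_ge (hp0 : ∀ x, 0 ≤ p x) (hp1 : ∑ x, p x = 1)
    (hμ : ∑ x, p x * ι x = μ) (hσ0 : 0 ≤ σ) (hσ : ∑ x, p x * (ι x - μ) ^ 2 = σ ^ 2)
    {z : ℝ} (hz : Qfun z < 1) {K : ℝ} (hK : 0 ≤ K) :
    ∃ C : ℝ, 0 ≤ C ∧ ∃ N : ℕ, ∀ n : ℕ, N ≤ n → Qfun z + K / Real.sqrt n ≤
      prodExp (fun _ : Fin n => p) (fun x => if μ * n + σ * Real.sqrt n * z - C * Real.log n <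
        ∑ i, ι (x i) then 1 else 0) := by
  have hQ := Qfun_add_Qfun_neg z
  obtain ⟨C, hC, N, hN⟩ := exists_iid_upper_tail (ι := fun x => -ι x) (μ := -μ) (z := -z) hp0 hp1
    (by simp [hμ]) hσ0 (by rw [← hσ]; exact Finset.sum_congr rfl fun x _ => by ring)
    (by linarith) hK
  refine ⟨C, hC, N, fun n hn => ?_⟩
  have h := hN n hn
  have e : prodExp (fun _ : Fin n => p) (fun x => if μ * n + σ * Real.sqrt n * z - C * Real.log n <
        ∑ i, ι (x i) then 1 else 0) = 1 - prodExp (fun _ : Fin n => p) (fun x =>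
        if -μ * n + σ * Real.sqrt n * -z + C * Real.log n ≤ ∑ i, -ι (x i) then 1 else 0) := by
    rw [eq_sub_iff_add_eq, ← prodExp_add]
    refine Eq.trans ?_ (prodExp_const (v := fun _ : Fin n => p) (fun _ => hp1) 1)
    congr 1
    funext x
    rw [Finset.sum_neg_distrib]
    split_ifs with h1 h2 h2
    · linarith
    · simp
    · simp
    · linarith
  rw [e]
  linarith

end iidTail

section converse

variable {𝒳 𝒴 : Type} [Fintype 𝒳] {p ι : 𝒳 → ℝ} {d : 𝒳 → 𝒴 → ℝ} {D θ : ℝ}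

/-- A source word of tilted information above `a` is covered by a codebook `Cb` with probability at
most `Cb.card * exp (-a)`. -/
lemma prodExp_tilted_le (hp0 : ∀ x, 0 ≤ p x) (hθ : 0 ≤ θ)
    (hkkt : ∀ y, ∑ x, p x * Real.exp (θ * (D - d x y) + ι x) ≤ 1) {n : ℕ}
    (Cb : Finset (Fin n → 𝒴)) (a : ℝ) :
    prodExp (fun _ : Fin n => p) (fun x => if a < ∑ i, ι (x i) then 1 else 0) ≤
      prodExp (fun _ : Fin n => p)
        (fun x => if ∀ y ∈ Cb, (n : ℝ) * D < ∑ i, d (x i) (y i) then 1 else 0) +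
      Cb.card * Real.exp (-a) := by
  have hpt : ∀ x : Fin n → 𝒳, (if a < ∑ i, ι (x i) then 1 else 0 : ℝ) ≤
      (if ∀ y ∈ Cb, (n : ℝ) * D < ∑ i, d (x i) (y i) then 1 else 0) +
      ∑ y ∈ Cb, Real.exp (-a) * ∏ i, Real.exp (θ * (D - d (x i) (y i)) + ι (x i)) := by
    intro x
    have hnn : ∀ y ∈ Cb, 0 ≤ Real.exp (-a) *
        ∏ i, Real.exp (θ * (D - d (x i) (y i)) + ι (x i)) := fun y _ =>
      mul_nonneg (Real.exp_nonneg _) (Finset.prod_nonneg fun i _ => Real.exp_nonneg _)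
    have hnn' := Finset.sum_nonneg hnn
    by_cases hu : ∀ y ∈ Cb, (n : ℝ) * D < ∑ i, d (x i) (y i)
    · rw [if_pos hu]
      split_ifs <;> linarith
    rw [if_neg hu, zero_add]
    split_ifs with hx
    · push Not at hu
      obtain ⟨y, hy, hyd⟩ := hu
      refine le_trans ?_ (Finset.single_le_sum hnn hy)
      rw [← Real.exp_sum, ← Real.exp_add, Real.one_le_exp_iff, Finset.sum_add_distrib,
        ← Finset.mul_sum, Finset.sum_sub_distrib]
      simp only [Finset.sum_const, Finset.card_univ, Fintype.card_fin, nsmul_eq_mul]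
      have := mul_nonneg hθ (sub_nonneg.2 hyd)
      linarith
    · exact hnn'
  refine (prodExp_mono (fun _ => hp0) hpt).trans ?_
  rw [prodExp_add, prodExp_sum]
  refine add_le_add_right ?_ _
  rw [← nsmul_eq_mul, ← Finset.sum_const]
  refine Finset.sum_le_sum fun y _ => ?_
  rw [prodExp_const_mul, prodExp_prod (fun _ => p)
    (fun i x => Real.exp (θ * (D - d x (y i)) + ι x))]
  exact mul_le_of_le_one_right (Real.exp_nonneg _) (Finset.prod_le_one
    (fun i _ => Finset.sum_nonneg fun x _ => mul_nonneg (hp0 x) (Real.exp_nonneg _))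
    fun i _ => hkkt (y i))

lemma exists_converse {μ σ z : ℝ} (hp0 : ∀ x, 0 ≤ p x) (hp1 : ∑ x, p x = 1) (hθ : 0 ≤ θ)
    (hkkt : ∀ y, ∑ x, p x * Real.exp (θ * (D - d x y) + ι x) ≤ 1)
    (hμ : ∑ x, p x * ι x = μ) (hσ0 : 0 ≤ σ) (hσ : ∑ x, p x * (ι x - μ) ^ 2 = σ ^ 2)
    (hz : Qfun z < 1) :
    ∃ C : ℝ, 0 ≤ C ∧ ∃ N : ℕ, ∀ n : ℕ, N ≤ n → ∀ Cb : Finset (Fin n → 𝒴),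
      prodExp (fun _ : Fin n => p)
        (fun x => if ∀ y ∈ Cb, (n : ℝ) * D < ∑ i, d (x i) (y i) then 1 else 0) ≤ Qfun z →
      μ * n + σ * Real.sqrt n * z - C * Real.log n ≤ Real.log Cb.card := by
  obtain ⟨C, hC, N, hN⟩ := exists_iid_upper_tail_ge hp0 hp1 hμ hσ0 hσ hz zero_le_one
  refine ⟨C + 1 / 2, by positivity, max N 1, fun n hn Cb hCb => ?_⟩
  have hn0 : (0 : ℝ) < n := by
    have : 0 < n := (le_max_right N 1).trans hn
    exact_mod_cast this
  have h1 := hN n ((le_max_left _ _).trans hn)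
  set a := μ * n + σ * Real.sqrt n * z - C * Real.log n with ha
  have h2 := prodExp_tilted_le hp0 hθ hkkt Cb a
  have hs : 1 / Real.sqrt n = Real.exp (-(1 / 2 * Real.log n)) := by
    rw [Real.exp_neg, one_div, Real.sqrt_eq_rpow, Real.rpow_def_of_pos hn0, mul_comm (1 / 2 : ℝ)]
  rw [hs] at h1
  have h3 : Real.exp (a - 1 / 2 * Real.log n) ≤ Cb.card := by
    have h4 : Real.exp (-(1 / 2 * Real.log n)) ≤ Cb.card * Real.exp (-a) := by linarith
    have h5 := mul_le_mul_of_nonneg_right h4 (Real.exp_nonneg a)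
    rwa [mul_assoc, ← Real.exp_add, ← Real.exp_add, neg_add_cancel, Real.exp_zero, mul_one,
      neg_add_eq_sub] at h5
  have h6 := Real.log_le_log (Real.exp_pos _) h3
  rw [Real.log_exp] at h6
  linarith

end converse

lemma exists_le_prodExp {α : Type} [Fintype α] {n : ℕ} {v : Fin n → α → ℝ}
    (hv0 : ∀ i a, 0 ≤ v i a) (hv : ∀ i, ∑ a, v i a = 1) (G : (Fin n → α) → ℝ) :
    ∃ y, G y ≤ prodExp v G := by
  by_contra! hcon
  set S := prodExp v G with hS
  have h1 := prodExp_const hv 1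
  obtain ⟨y, -, hy⟩ := Finset.exists_ne_zero_of_sum_ne_zero (h1.trans_ne one_ne_zero)
  rw [mul_one] at hy
  have hw : ∀ y : Fin n → α, 0 ≤ ∏ i, v i (y i) := fun y => Finset.prod_nonneg fun i _ => hv0 i _
  have : prodExp v (fun _ => S) < prodExp v G :=
    Finset.sum_lt_sum (fun y _ => mul_le_mul_of_nonneg_left (hcon y).le (hw y))
      ⟨y, Finset.mem_univ y, mul_lt_mul_of_pos_left (hcon y) ((hw y).lt_of_ne' hy)⟩
  rw [prodExp_const hv, ← hS] at this
  exact lt_irrefl _ this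

section achievability

variable {𝒳 𝒴 : Type} [Fintype 𝒴] {p ι : 𝒳 → ℝ} {q : 𝒴 → ℝ} {d : 𝒳 → 𝒴 → ℝ}
  {D θ : ℝ}

/-- Change of measure from the tilted channel to the output law, on a window of distortions. -/
lemma le_prodExp_ball (hq0 : ∀ y, 0 ≤ q y) (hθ : 0 ≤ θ) {n : ℕ} (x : Fin n → 𝒳) (A : ℝ) :
    Real.exp (-(∑ i, ι (x i) + θ * A)) *
      prodExp (fun i y => q y * Real.exp (θ * (D - d (x i) y) + ι (x i)))
        (fun y => if n * D - A ≤ ∑ i, d (x i) (y i) ∧ ∑ i, d (x i) (y i) ≤ n * D then 1 else 0) ≤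
    prodExp (fun _ : Fin n => q)
      (fun y => if (n : ℝ) * D < ∑ i, d (x i) (y i) then 0 else 1) := by
  rw [← prodExp_const_mul]
  refine Finset.sum_le_sum fun y _ => ?_
  beta_reduce
  have hu0 : 0 ≤ ∏ i, q (y i) := Finset.prod_nonneg fun i _ => hq0 _
  by_cases hy : n * D - A ≤ ∑ i, d (x i) (y i) ∧ ∑ i, d (x i) (y i) ≤ n * D
  · rw [if_pos hy, if_neg hy.2.not_gt, mul_one, mul_one, Finset.prod_mul_distrib, mul_assoc,
      ← Real.exp_sum, ← Real.exp_add]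
    refine mul_le_of_le_one_right hu0 (Real.exp_le_one_iff.2 ?_)
    rw [Finset.sum_add_distrib, ← Finset.mul_sum, Finset.sum_sub_distrib]
    simp only [Finset.sum_const, Finset.card_univ, Fintype.card_fin, nsmul_eq_mul]
    have := mul_le_mul_of_nonneg_left (show n * D - ∑ i, d (x i) (y i) ≤ A by linarith [hy.1]) hθ
    linarith
  · rw [if_neg hy, mul_zero, mul_zero]
    exact mul_nonneg hu0 (by split_ifs <;> norm_num)

variable [Fintype 𝒳]

/-- Random coding: if all source words outside `bad` have a distortion ball of probability at least
`r`, some codebook of size at most `M` misses little more than `bad`. -/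
lemma exists_codebook (hp0 : ∀ x, 0 ≤ p x) (hp1 : ∑ x, p x = 1) (hq0 : ∀ y, 0 ≤ q y)
    (hq1 : ∑ y, q y = 1) {n M : ℕ} (hM : 0 < M) (D : ℝ) {bad : (Fin n → 𝒳) → ℝ}
    (hbad : ∀ x, 0 ≤ bad x) {r : ℝ}
    (hr : ∀ x, bad x < 1 → r ≤ prodExp (fun _ : Fin n => q)
      (fun y => if (n : ℝ) * D < ∑ i, d (x i) (y i) then 0 else 1)) :
    ∃ Cb : Finset (Fin n → 𝒴), 0 < Cb.card ∧ Cb.card ≤ M ∧ prodExp (fun _ : Fin n => p)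
        (fun x => if ∀ y ∈ Cb, (n : ℝ) * D < ∑ i, d (x i) (y i) then 1 else 0) ≤
      prodExp (fun _ : Fin n => p) bad + Real.exp (-(M * r)) := by
  classical
  set u : (Fin n → 𝒴) → ℝ := fun y => ∏ i, q (y i) with hu
  have hu0 : ∀ y, 0 ≤ u y := fun y => Finset.prod_nonneg fun i _ => hq0 _
  have hu1 : ∑ y, u y = 1 := by
    have := prodExp_const (v := fun _ : Fin n => q) (fun _ => hq1) 1
    simpa [prodExp] using this
  set miss : (Fin n → 𝒳) → (Fin n → 𝒴) → ℝ :=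
    fun x y => if (n : ℝ) * D < ∑ i, d (x i) (y i) then 1 else 0 with hmiss
  have hmiss0 : ∀ x y, 0 ≤ miss x y := fun x y => by
    simp only [hmiss]
    split_ifs <;> norm_num
  have hmiss1 : ∀ x y, miss x y ≤ 1 := fun x y => by
    simp only [hmiss]
    split_ifs <;> norm_num
  obtain ⟨c, hc⟩ := exists_le_prodExp (n := M) (v := fun _ => u) (fun _ => hu0) (fun _ => hu1)
    (fun c => prodExp (fun _ : Fin n => p) (fun x => ∏ j, miss x (c j)))
  refine ⟨Finset.univ.image c, ?_, Finset.card_image_le.trans (by simp), ?_⟩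
  · exact Finset.card_pos.2 ⟨c ⟨0, hM⟩, Finset.mem_image_of_mem _ (Finset.mem_univ _)⟩
  refine (le_of_eq ?_).trans (hc.trans ?_)
  · congr 1
    funext x
    split_ifs with h
    · exact (Finset.prod_eq_one fun j _ => if_pos (h _
        (Finset.mem_image_of_mem _ (Finset.mem_univ j)))).symm
    · push Not at h
      obtain ⟨y, hy, hyd⟩ := h
      obtain ⟨j, -, rfl⟩ := Finset.mem_image.1 hy
      exact (Finset.prod_eq_zero (Finset.mem_univ j) (if_neg hyd.not_gt)).symm
  have e2 : prodExp (fun _ : Fin M => u)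
      (fun c => prodExp (fun _ : Fin n => p) (fun x => ∏ j, miss x (c j))) =
      prodExp (fun _ : Fin n => p) (fun x => (∑ y, u y * miss x y) ^ M) := by
    have : ∀ x, prodExp (fun _ : Fin M => u) (fun c => ∏ j, miss x (c j)) =
        (∑ y, u y * miss x y) ^ M := fun x => by
      rw [prodExp_prod (fun _ => u) (fun _ => miss x)]
      simp
    simp_rw [← this]
    simp only [prodExp, Finset.mul_sum]
    rw [Finset.sum_comm]
    exact Finset.sum_congr rfl fun x _ => Finset.sum_congr rfl fun c _ => by ring
  rw [e2, ← prodExp_const (v := fun _ : Fin n => p) (fun _ => hp1) (Real.exp (-(M * r))),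
    ← prodExp_add]
  refine prodExp_mono (fun _ => hp0) fun x => ?_
  have hs0 : 0 ≤ ∑ y, u y * miss x y := Finset.sum_nonneg fun y _ => mul_nonneg (hu0 y) (hmiss0 x y)
  have hs1 : ∑ y, u y * miss x y ≤ 1 := by
    rw [← hu1]
    exact Finset.sum_le_sum fun y _ => mul_le_of_le_one_right (hu0 y) (hmiss1 x y)
  by_cases hx : bad x < 1
  · have h1 := hr x hx
    have e3 : prodExp (fun _ : Fin n => q)
        (fun y => if (n : ℝ) * D < ∑ i, d (x i) (y i) then 0 else 1) =
        1 - ∑ y, u y * miss x y := by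
      rw [eq_sub_iff_add_eq, prodExp, ← Finset.sum_add_distrib]
      refine Eq.trans ?_ hu1
      refine Finset.sum_congr rfl fun y _ => ?_
      simp only [hmiss, hu]
      split_ifs <;> ring
    rw [e3] at h1
    have h2 : ∑ y, u y * miss x y ≤ Real.exp (-r) := by
      have := Real.add_one_le_exp (-r)
      linarith
    refine (pow_le_pow_left₀ hs0 h2 M).trans ?_
    rw [← Real.exp_nat_mul, mul_neg]
    exact le_add_of_nonneg_left (hbad x)
  · have := pow_le_one₀ hs0 hs1 (n := M)
    have := Real.exp_nonneg (-(M * r))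
    linarith

end achievability

/-- A sum of i.i.d. centred variables bounded by `B` exceeds `B * √(n log n)` with probability at
most `n ^ (-1 / 2)`. -/
lemma prodExp_iid_deviation {α : Type} [Fintype α] {p ξ : α → ℝ} (hp0 : ∀ a, 0 ≤ p a)
    (hp1 : ∑ a, p a = 1) (hξ : ∑ a, p a * ξ a = 0) {B : ℝ} (hB : 0 < B) (hξB : ∀ a, |ξ a| ≤ B)
    {n : ℕ} (hn : 0 < n) :
    prodExp (fun _ : Fin n => p)
      (fun x => if B * Real.sqrt (n * Real.log n) ≤ ∑ i, ξ (x i) then 1 else 0) ≤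
      1 / Real.sqrt n := by
  have hn0 : (0 : ℝ) < n := by exact_mod_cast hn
  have hlog : 0 ≤ Real.log n := Real.log_natCast_nonneg n
  refine (prodExp_hoeffding (v := fun _ : Fin n => p) (ξ := fun _ => ξ) (fun _ => hp0)
    (fun _ => hp1) (fun _ => hξ) hB (fun _ => hξB) hn
    (t := B * Real.sqrt (n * Real.log n)) (by positivity)).trans (le_of_eq ?_)
  rw [mul_pow, Real.sq_sqrt (by positivity), one_div, Real.sqrt_eq_rpow,
    Real.rpow_def_of_pos hn0, ← Real.exp_neg]
  congr 1
  field_simp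

section achievability

variable {𝒳 𝒴 : Type} [Fintype 𝒳] [Fintype 𝒴] {p ι : 𝒳 → ℝ} {q : 𝒴 → ℝ} {d : 𝒳 → 𝒴 → ℝ}
  {D θ : ℝ}

/-- Outside an event of probability `O(n ^ (-1 / 2))`, the distortion ball around a source word has
output probability at least the exponential of minus its tilted information, up to a polynomial
factor. -/
lemma exists_ball_lower_bound (hp0 : ∀ x, 0 ≤ p x) (hp1 : ∑ x, p x = 1) (hq0 : ∀ y, 0 ≤ q y)
    (hd : ∀ x y, 0 ≤ d x y) (hθ : 0 ≤ θ)
    (hw1 : ∀ x, ∑ y, q y * Real.exp (θ * (D - d x y) + ι x) = 1)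
    (hwD : ∑ x, p x * ∑ y, q y * Real.exp (θ * (D - d x y) + ι x) * d x y = D)
    {x₀ : 𝒳} {y₁ y₂ : 𝒴} (hx₀ : 0 < p x₀) (hy₁ : 0 < q y₁) (hy₂ : 0 < q y₂)
    (hne : d x₀ y₁ ≠ d x₀ y₂) :
    ∃ C : ℝ, 0 ≤ C ∧ ∃ N : ℕ, ∀ n : ℕ, N ≤ n → ∃ bad : (Fin n → 𝒳) → ℝ, (∀ x, 0 ≤ bad x) ∧
      prodExp (fun _ : Fin n => p) bad ≤ 3 / Real.sqrt n ∧
      ∀ x, bad x < 1 → Real.exp (-(∑ i, ι (x i) + C * Real.log n)) ≤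
        prodExp (fun _ : Fin n => q)
          (fun y => if (n : ℝ) * D < ∑ i, d (x i) (y i) then 0 else 1) := by
  classical
  set w : 𝒳 → 𝒴 → ℝ := fun x y => q y * Real.exp (θ * (D - d x y) + ι x) with hw
  have hw0 : ∀ x y, 0 ≤ w x y := fun x y => mul_nonneg (hq0 y) (Real.exp_nonneg _)
  have hwpos : ∀ x y, 0 < q y → 0 < w x y := fun x y h => mul_pos h (Real.exp_pos _)
  set B := ∑ x, ∑ y, d x y + 1 with hB
  have hB0 : 0 < B := add_pos_of_nonneg_of_pos
    (Finset.sum_nonneg fun x _ => Finset.sum_nonneg fun y _ => hd x y) one_pos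
  have hdB : ∀ x y, d x y ≤ B := fun x y => by
    have h1 := Finset.single_le_sum (f := fun y => d x y) (fun y _ => hd x y) (Finset.mem_univ y)
    have h2 := Finset.single_le_sum (f := fun x => ∑ y, d x y)
      (fun x _ => Finset.sum_nonneg fun y _ => hd x y) (Finset.mem_univ x)
    linarith
  set e : 𝒳 → ℝ := fun x => ∑ y, w x y * d x y with he
  have he0 : ∀ x, 0 ≤ e x := fun x => Finset.sum_nonneg fun y _ => mul_nonneg (hw0 x y) (hd x y)
  have heB : ∀ x, e x ≤ B := fun x => by
    calc e x ≤ ∑ y, w x y * B :=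
          Finset.sum_le_sum fun y _ => mul_le_mul_of_nonneg_left (hdB x y) (hw0 x y)
      _ = B := by rw [← Finset.sum_mul, hw1, one_mul]
  have hD0 : 0 ≤ D := hwD ▸ Finset.sum_nonneg fun x _ => mul_nonneg (hp0 x) (he0 x)
  have hDB : D ≤ B := by
    calc D = ∑ x, p x * e x := hwD.symm
      _ ≤ ∑ x, p x * B := Finset.sum_le_sum fun x _ => mul_le_mul_of_nonneg_left (heB x) (hp0 x)
      _ = B := by rw [← Finset.sum_mul, hp1, one_mul]
  have hcent : ∑ x, p x * (e x - D) = 0 := by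
    simp_rw [mul_sub]
    rw [Finset.sum_sub_distrib, ← Finset.sum_mul, hp1, one_mul]
    exact sub_eq_zero.2 hwD
  have hcent' : ∑ x, p x * (D - e x) = 0 := by
    rw [← neg_eq_zero, ← Finset.sum_neg_distrib, ← hcent]
    exact Finset.sum_congr rfl fun x _ => by ring
  have hbd : ∀ x, |e x - D| ≤ B := fun x =>
    abs_le.2 ⟨by linarith [he0 x, hDB], by linarith [heB x, hD0]⟩
  have hpx₀ : p x₀ ≤ 1 :=
    hp1 ▸ Finset.single_le_sum (f := p) (fun x _ => hp0 x) (Finset.mem_univ x₀)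
  have hcount : ∑ x, p x * (p x₀ - if x = x₀ then 1 else 0) = 0 := by
    simp_rw [mul_sub]
    rw [Finset.sum_sub_distrib, ← Finset.sum_mul, hp1]
    simp
  have hcountbd : ∀ x, |p x₀ - if x = x₀ then 1 else 0| ≤ 1 := fun x => by
    split_ifs
    · exact abs_le.2 ⟨by linarith, by linarith⟩
    · exact abs_le.2 ⟨by linarith, by linarith⟩
  obtain ⟨A, C, hA, hC, N₁, hN₁⟩ := exists_moderate_window (w := w) (d := d) hw0 hw1 hB0 hd hdB
    (hwpos x₀ y₁ hy₁) (hwpos x₀ y₂ hy₂) hne (ρ := p x₀ / 2) (by positivity) hB0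
  obtain ⟨N₂, hN₂⟩ := exists_forall_ge_log (max ((2 / p x₀) ^ 2) 1)
  refine ⟨C + θ * A, by positivity, max N₁ N₂, fun n hn => ?_⟩
  obtain ⟨hn1, -, hn3, hn4⟩ := hN₂ n ((le_max_right _ _).trans hn)
  have hnpos : 0 < n := by omega
  have hn0 : (0 : ℝ) < n := by exact_mod_cast hnpos
  have hlog1 : 1 ≤ Real.log n := (le_max_right _ _).trans hn3
  set t := Real.sqrt (n * Real.log n) with ht
  have htle : t ≤ p x₀ / 2 * n := by
    refine Real.sqrt_le_iff.2 ⟨by positivity, ?_⟩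
    have h1 : (2 / p x₀) ^ 2 * Real.log n ≤ n :=
      (mul_le_mul_of_nonneg_right (le_max_left _ _) (by linarith)).trans hn1
    rw [div_pow, div_mul_eq_mul_div, div_le_iff₀ (by positivity)] at h1
    have h2 := mul_le_mul_of_nonneg_left h1 hn0.le
    linarith
  refine ⟨fun x => (if B * t ≤ ∑ i, (e (x i) - D) then 1 else 0) +
    (if B * t ≤ ∑ i, (D - e (x i)) then 1 else 0) +
    (if 1 * t ≤ ∑ i, (p x₀ - if x i = x₀ then 1 else 0) then 1 else 0), fun x => ?_, ?_,
    fun x hx => ?_⟩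
  · refine add_nonneg (add_nonneg ?_ ?_) ?_ <;> split_ifs <;> norm_num
  · rw [prodExp_add, prodExp_add]
    have h1 := prodExp_iid_deviation hp0 hp1 hcent hB0 hbd hnpos
    have h2 := prodExp_iid_deviation hp0 hp1 hcent' hB0
      (fun x => by rw [abs_sub_comm]; exact hbd x) hnpos
    have h3 := prodExp_iid_deviation hp0 hp1 hcount one_pos hcountbd hnpos
    rw [show (3 : ℝ) / Real.sqrt n = 1 / Real.sqrt n + 1 / Real.sqrt n + 1 / Real.sqrt n by ring]
    exact add_le_add (add_le_add h1 h2) h3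
  · beta_reduce at hx
    have g1 : ¬ B * t ≤ ∑ i, (e (x i) - D) := fun h => by
      rw [if_pos h] at hx
      split_ifs at hx <;> linarith
    have g2 : ¬ B * t ≤ ∑ i, (D - e (x i)) := fun h => by
      rw [if_pos h] at hx
      split_ifs at hx <;> linarith
    have g3 : ¬ 1 * t ≤ ∑ i, (p x₀ - if x i = x₀ then 1 else 0) := fun h => by
      rw [if_pos h] at hx
      split_ifs at hx
      all_goals linarith
    rw [Finset.sum_sub_distrib] at g1 g2 g3
    simp only [Finset.sum_const, Finset.card_univ, Fintype.card_fin, nsmul_eq_mul] at g1 g2 g3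
    have hwin := hN₁ n ((le_max_left _ _).trans hn) x (n * D)
      (abs_le.2 ⟨by linarith, by linarith⟩) (by linarith)
    refine le_trans ?_ (le_prodExp_ball (ι := ι) (D := D) hq0 hθ x A)
    refine le_trans ?_ (mul_le_mul_of_nonneg_left hwin (Real.exp_nonneg _))
    rw [← Real.exp_add]
    refine Real.exp_le_exp.2 ?_
    have h1 : θ * A ≤ θ * A * Real.log n := le_mul_of_one_le_right (by positivity) hlog1
    linarith

end achievability

/-- Random coding with the optimal output distribution attains the second-order rate. -/
lemma exists_achievability {𝒳 𝒴 : Type} [Fintype 𝒳] [Fintype 𝒴] {p ι : 𝒳 → ℝ} {q : 𝒴 → ℝ}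
    {d : 𝒳 → 𝒴 → ℝ} {D θ μ σ z : ℝ}
    (hp0 : ∀ x, 0 ≤ p x) (hp1 : ∑ x, p x = 1) (hq0 : ∀ y, 0 ≤ q y) (hq1 : ∑ y, q y = 1)
    (hd : ∀ x y, 0 ≤ d x y) (hθ : 0 ≤ θ)
    (hw1 : ∀ x, ∑ y, q y * Real.exp (θ * (D - d x y) + ι x) = 1)
    (hwD : ∑ x, p x * ∑ y, q y * Real.exp (θ * (D - d x y) + ι x) * d x y = D)
    {x₀ : 𝒳} {y₁ y₂ : 𝒴} (hx₀ : 0 < p x₀) (hy₁ : 0 < q y₁) (hy₂ : 0 < q y₂)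
    (hne : d x₀ y₁ ≠ d x₀ y₂) (hμ0 : 0 < μ)
    (hμ : ∑ x, p x * ι x = μ) (hσ0 : 0 ≤ σ) (hσ : ∑ x, p x * (ι x - μ) ^ 2 = σ ^ 2)
    (hz : 0 < Qfun z) :
    ∃ C : ℝ, 0 ≤ C ∧ ∃ N : ℕ, ∀ n : ℕ, N ≤ n → ∃ Cb : Finset (Fin n → 𝒴), 0 < Cb.card ∧
      prodExp (fun _ : Fin n => p)
        (fun x => if ∀ y ∈ Cb, (n : ℝ) * D < ∑ i, d (x i) (y i) then 1 else 0) ≤ Qfun z ∧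
      Real.log Cb.card ≤ μ * n + σ * Real.sqrt n * z + C * Real.log n := by
  obtain ⟨C₁, hC₁, N₁, hN₁⟩ := exists_iid_upper_tail (ι := ι) hp0 hp1 hμ hσ0 hσ hz (K := 4)
    (by norm_num)
  obtain ⟨C₂, hC₂, N₂, hN₂⟩ :=
    exists_ball_lower_bound (ι := ι) hp0 hp1 hq0 hd hθ hw1 hwD hx₀ hy₁ hy₂ hne
  obtain ⟨N₃, hN₃⟩ := exists_forall_le_sqrt (σ * |z| / μ)
  refine ⟨C₁ + C₂ + 2, by positivity, max N₁ (max N₂ N₃), fun n hn => ?_⟩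
  have htail := hN₁ n ((le_max_left _ _).trans hn)
  obtain ⟨bad, hbad0, hbad, hball⟩ :=
    hN₂ n ((le_max_left _ _).trans ((le_max_right _ _).trans hn))
  obtain ⟨hsq, hlog1, hn3⟩ := hN₃ n ((le_max_right _ _).trans ((le_max_right _ _).trans hn))
  have hn0 : (0 : ℝ) < n := by
    have : 0 < n := by omega
    exact_mod_cast this
  set s := Real.sqrt n with hs
  have hs0 : 0 < s := Real.sqrt_pos.2 hn0
  have hss : s * s = n := Real.mul_self_sqrt hn0.le
  set a := μ * n + σ * s * z + C₁ * Real.log n with ha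
  set u := a + (C₂ + 1) * Real.log n with hu
  have hu0 : 0 ≤ u := by
    have h1 : σ * |z| ≤ s * μ := (div_le_iff₀ hμ0).1 hsq
    have h2 : σ * |z| * s ≤ s * μ * s := mul_le_mul_of_nonneg_right h1 hs0.le
    have h3 : s * μ * s = μ * n := by rw [← hss]; ring
    have h4 : -(σ * |z| * s) ≤ σ * s * z := by
      have := mul_le_mul_of_nonneg_left (neg_abs_le z) (mul_nonneg hσ0 hs0.le)
      linarith
    have h5 : 0 ≤ C₁ * Real.log n := mul_nonneg hC₁ (by linarith)
    have h6 : 0 ≤ (C₂ + 1) * Real.log n := mul_nonneg (by linarith) (by linarith)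
    linarith
  have hMpos : 0 < ⌈Real.exp u⌉₊ := Nat.ceil_pos.2 (Real.exp_pos u)
  obtain ⟨Cb, hCb0, hCbM, hCb⟩ := exists_codebook (M := ⌈Real.exp u⌉₊)
    (bad := fun x => bad x + if a ≤ ∑ i, ι (x i) then 1 else 0)
    (r := Real.exp (-(a + C₂ * Real.log n))) (d := d) hp0 hp1 hq0 hq1 hMpos D
    (fun x => add_nonneg (hbad0 x) (by split_ifs <;> norm_num)) (fun x hx => by
      have hxa : ¬ a ≤ ∑ i, ι (x i) := fun h => by
        rw [if_pos h] at hx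
        linarith [hbad0 x]
      rw [if_neg hxa, add_zero] at hx
      refine le_trans (Real.exp_le_exp.2 ?_) (hball x hx)
      linarith [not_le.1 hxa])
  refine ⟨Cb, hCb0, hCb.trans ?_, ?_⟩
  · rw [prodExp_add]
    have hMr : (n : ℝ) ≤ ⌈Real.exp u⌉₊ * Real.exp (-(a + C₂ * Real.log n)) := by
      calc (n : ℝ) = Real.exp u * Real.exp (-(a + C₂ * Real.log n)) := by
            rw [← Real.exp_add, hu, show a + (C₂ + 1) * Real.log n + -(a + C₂ * Real.log n) =
              Real.log n by ring, Real.exp_log hn0]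
        _ ≤ _ := mul_le_mul_of_nonneg_right (Nat.le_ceil _) (Real.exp_nonneg _)
    have hexp : Real.exp (-(⌈Real.exp u⌉₊ * Real.exp (-(a + C₂ * Real.log n)))) ≤ 1 / s := by
      refine (Real.exp_le_exp.2 (neg_le_neg hMr)).trans ?_
      rw [Real.exp_neg, ← one_div]
      refine one_div_le_one_div_of_le hs0 ?_
      have h1 : s ≤ n := by
        have hn1 : (1 : ℝ) ≤ n := by
          have : 1 ≤ n := by omega
          exact_mod_cast this
        exact Real.sqrt_le_iff.2 ⟨hn0.le, le_self_pow₀ hn1 two_ne_zero⟩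
      linarith [Real.add_one_le_exp (n : ℝ)]
    have h4 : 3 / s + 1 / s = 4 / s := by ring
    linarith
  · have hcard : (Cb.card : ℝ) ≤ 2 * Real.exp u := by
      have h1 : (Cb.card : ℝ) ≤ ⌈Real.exp u⌉₊ := by exact_mod_cast hCbM
      have h2 := Nat.ceil_lt_add_one (Real.exp_nonneg u)
      have h3 := Real.one_le_exp hu0
      linarith
    have h1 := Real.log_le_log (by exact_mod_cast hCb0) hcard
    rw [Real.log_mul two_ne_zero (Real.exp_ne_zero u), Real.log_exp] at h1
    have h2 : Real.log 2 ≤ 1 := by linarith [Real.log_two_lt_d9]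
    linarith

lemma sum_ofReal_uncovered_le_iff {𝒳 𝒴 : Type} [Fintype 𝒳] {p : 𝒳 → ℝ} {d : 𝒳 → 𝒴 → ℝ}
    {D ε : ℝ} (hp0 : ∀ x, 0 ≤ p x) (hε : 0 ≤ ε) {n : ℕ} (Cb : Finset (Fin n → 𝒴)) :
    (∑ xs : Fin n → 𝒳, if ∀ ys ∈ Cb, (n : ℝ) * D < ∑ i, d (xs i) (ys i)
      then ENNReal.ofReal (∏ i, p (xs i)) else 0) ≤ ENNReal.ofReal ε ↔
    prodExp (fun _ : Fin n => p)
      (fun x => if ∀ y ∈ Cb, (n : ℝ) * D < ∑ i, d (x i) (y i) then 1 else 0) ≤ ε := by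
  rw [← ENNReal.ofReal_le_ofReal_iff hε, prodExp, ENNReal.ofReal_sum_of_nonneg]
  · refine iff_of_eq (congrArg (· ≤ ENNReal.ofReal ε) (Finset.sum_congr rfl fun x _ => ?_))
    split_ifs <;> simp
  · intro x _
    refine mul_nonneg (Finset.prod_nonneg fun i _ => hp0 _) ?_
    split_ifs <;> norm_num

/-- Second-order asymptotics of the minimum fixed-length rate for a stationary
memoryless source with additive distortion (Kostina–Verdú):
`R*_F(n,D,ε) = R_X(D) + √(V_X(D)/n)·Q⁻¹(ε) + O((log n)/n)`,
where `z = Q⁻¹(ε)` is the unique real with `Q(z) = ε`. -/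
theorem stmt9 {𝒳 𝒴 : Type} [Fintype 𝒳] [Fintype 𝒴] [Nonempty 𝒳] [Nonempty 𝒴]
    (p : 𝒳 → ℝ) (hp0 : ∀ x, 0 ≤ p x) (hp1 : ∑ x, p x = 1)
    (d : 𝒳 → 𝒴 → ℝ) (hd : ∀ x y, 0 ≤ d x y)
    (D ε : ℝ) (hε : 0 < ε ∧ ε < 1)
    (hDmin : sInf {D' : ℝ | 0 ≤ D' ∧ ∃ W : 𝒳 → 𝒴 → ℝ,
      IsRChannel W ∧ expDist p d W ≤ D'} < D)
    (hDmax : ∀ y : 𝒴, D < ∑ x, p x * d x y)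
    (Wstar : 𝒳 → 𝒴 → ℝ) (hWch : IsRChannel Wstar) (hWfeas : expDist p d Wstar ≤ D)
    (hWopt : mutualInfo p Wstar = RDfun p d D)
    (hdiff : DifferentiableAt ℝ (RDfun p d) D)
    (z : ℝ) (hz : Qfun z = ε) :
    ∃ C : ℝ, 0 < C ∧ ∃ N : ℕ, ∀ n : ℕ, N ≤ n →
      |sInf {r : ℝ | ∃ M : ℕ, 0 < M ∧ (∃ Cb : Finset (Fin n → 𝒴), Cb.card = M ∧
            (∑ xs : Fin n → 𝒳, if ∀ ys ∈ Cb, (n : ℝ) * D < ∑ i, d (xs i) (ys i)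
              then ENNReal.ofReal (∏ i, p (xs i)) else 0) ≤ ENNReal.ofReal ε) ∧
            r = Real.logb 2 M / n}
          - RDfun p d D
          - Real.sqrt (dispersionV p d D (outMarg p Wstar) / n) * z|
        ≤ C * Real.log n / n := by
  obtain ⟨θ, hθ, ι, hι, hw1, hμ, hwD, hkkt, x₀, y₁, y₂, hx₀, hy₁, hy₂, hne⟩ :=
    rateDistortion_optimality hp0 hp1 hDmax hWch hWfeas hWopt hdiff
  have hR0 := RDfun_pos hp0 hp1 hDmax hWch hWfeas hWopt
  have hl2 : 0 < Real.log 2 := Real.log_pos one_lt_two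
  set R := RDfun p d D with hR
  set V := dispersionV p d D (outMarg p Wstar) with hV
  have hV0 : 0 ≤ V := Finset.sum_nonneg fun x _ => mul_nonneg (hp0 x) (sq_nonneg _)
  set σ := Real.sqrt V * Real.log 2 with hσ
  have hσ0 : 0 ≤ σ := by positivity
  have hvar : ∑ x, p x * (ι x - R * Real.log 2) ^ 2 = σ ^ 2 := by
    rw [hσ, mul_pow, Real.sq_sqrt hV0, hV, dispersionV, Finset.sum_mul, ← hμ]
    have hmean : ∑ x, p x * ι x =
        (∑ x, p x * DtiltedInfo p d D (outMarg p Wstar) x) * Real.log 2 := by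
      rw [Finset.sum_mul]
      exact Finset.sum_congr rfl fun x _ => by rw [← hι, mul_assoc]
    rw [hmean]
    exact Finset.sum_congr rfl fun x _ => by rw [← hι]; ring
  obtain ⟨C₁, hC₁, N₁, hN₁⟩ := exists_converse (ι := ι) (d := d) hp0 hp1 hθ.le hkkt hμ hσ0 hvar
    (z := z) (hz ▸ hε.2)
  obtain ⟨C₂, hC₂, N₂, hN₂⟩ := exists_achievability (ι := ι) hp0 hp1 (outMarg_nonneg hp0 hWch)
    (sum_outMarg hp1 hWch) hd hθ.le hw1 hwD hx₀ hy₁ hy₂ hne (by positivity) hμ hσ0 hvar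
    (z := z) (hz ▸ hε.1)
  refine ⟨(C₁ + C₂) / Real.log 2 + 1, by positivity, max N₁ (max N₂ 1), fun n hn => ?_⟩
  have hn0 : (0 : ℝ) < n := by
    have : 0 < n := (le_max_right N₂ 1).trans ((le_max_right _ _).trans hn)
    exact_mod_cast this
  have hlog : 0 ≤ Real.log n := Real.log_natCast_nonneg n
  have hconv := hN₁ n ((le_max_left _ _).trans hn)
  obtain ⟨Cb, hCb0, hCb, hCbcard⟩ := hN₂ n ((le_max_left _ _).trans ((le_max_right _ _).trans hn))
  rw [hz] at hconv hCb
  set S := {r : ℝ | ∃ M : ℕ, 0 < M ∧ (∃ Cb : Finset (Fin n → 𝒴), Cb.card = M ∧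
            (∑ xs : Fin n → 𝒳, if ∀ ys ∈ Cb, (n : ℝ) * D < ∑ i, d (xs i) (ys i)
              then ENNReal.ofReal (∏ i, p (xs i)) else 0) ≤ ENNReal.ofReal ε) ∧
            r = Real.logb 2 M / n} with hS
  have hmem : Real.logb 2 Cb.card / n ∈ S :=
    ⟨Cb.card, hCb0, ⟨Cb, rfl, (sum_ofReal_uncovered_le_iff hp0 hε.1.le Cb).2 hCb⟩, rfl⟩
  have hlow : ∀ r ∈ S, (R * Real.log 2 * n + σ * Real.sqrt n * z - C₁ * Real.log n) /
      Real.log 2 / n ≤ r := by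
    rintro r ⟨M, -, ⟨Cb', rfl, h⟩, rfl⟩
    rw [Real.logb]
    gcongr
    exact hconv Cb' ((sum_ofReal_uncovered_le_iff hp0 hε.1.le Cb').1 h)
  have hup : sInf S ≤ (R * Real.log 2 * n + σ * Real.sqrt n * z + C₂ * Real.log n) /
      Real.log 2 / n := by
    refine (csInf_le ⟨_, hlow⟩ hmem).trans ?_
    rw [Real.logb]
    gcongr
  have hlo := le_csInf ⟨_, hmem⟩ hlow
  have hsplit : ∀ c : ℝ, (R * Real.log 2 * n + σ * Real.sqrt n * z + c * Real.log n) /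
      Real.log 2 / n = R + Real.sqrt (V / n) * z + c / Real.log 2 * (Real.log n / n) := fun c => by
    rw [Real.sqrt_div hV0, hσ]
    have hs0 : 0 < Real.sqrt n := Real.sqrt_pos.2 hn0
    have hss : Real.sqrt n / n = 1 / Real.sqrt n := Real.sqrt_div_self'
    have : Real.sqrt V / Real.sqrt n = Real.sqrt V * (Real.sqrt n / n) := by rw [hss]; ring
    rw [this]
    field_simp
  rw [hsplit] at hup
  rw [sub_eq_add_neg (_ + _), ← neg_mul, hsplit] at hlo
  have hL : 0 ≤ Real.log n / n := by positivity
  have h1 : 0 ≤ C₁ / Real.log 2 * (Real.log n / n) := by positivity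
  have h2 : 0 ≤ C₂ / Real.log 2 * (Real.log n / n) := by positivity
  rw [mul_div_assoc, add_mul, add_div, add_mul, one_mul]
  rw [neg_div, neg_mul] at hlo
  exact abs_le.2 ⟨by linarith, by linarith⟩

end
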